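/- arXiv:1805.02945 — 2 statements merged into one kernel-verified Lean document; each statement's English description precedes it below -/
import Mathlib

section
/- For every ε > 0 there exists a constant C = C(ε) > 0 such that for all positive integers m and n, the number of solutions of m/n = 1/a₁ + 1/a₂ + 1/a₃ in positive integers a₁, a₂, a₃ with a₁ ≤ a₂ ≤ a₃ is at most C · n^ε · (n³/m²)^(1/5); that is, f₃(m,n) ≤ C n^ε (n³/m²)^(1/5). -/
/-- `numSols k m n` is the number of nondecreasing `k`-tuples of positive integers
`(a₁, …, a_k)` with `m / n = 1/a₁ + ⋯ + 1/a_k`. -/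
noncomputable def numSols (k m n : ℕ) : ℕ :=
  Nat.card {a : Fin k → ℕ // (∀ i, 0 < a i) ∧ Monotone a ∧
    (m : ℚ) / n = ∑ i, (1 : ℚ) / a i}

lemma divisor_bound (δ : ℝ) (hδ : 0 < δ) : ∃ C : ℝ, 1 ≤ C ∧
    ∀ n : ℕ, 0 < n → (n.divisors.card : ℝ) ≤ C * (n : ℝ) ^ δ := by
  set x : ℝ := δ * Real.log 2 with hx
  have hxpos : 0 < x := mul_pos hδ (Real.log_pos (by norm_num))
  set M : ℝ := 1 + 1 / x with hM
  have hM1 : 1 ≤ M := by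
    have : 0 < 1 / x := by positivity
    linarith
  set P : ℕ := ⌈(2 : ℝ) ^ (1 / δ)⌉₊ with hP
  refine ⟨M ^ P, one_le_pow₀ hM1, ?_⟩
  intro n hn
  have h1 : (n.divisors.card : ℝ) = ∏ p ∈ n.primeFactors, ((n.factorization p : ℝ) + 1) := by
    rw [Nat.card_divisors hn.ne']
    push_cast
    rfl
  have h2 : (n : ℝ) ^ δ = ∏ p ∈ n.primeFactors, (((p : ℝ) ^ δ) ^ (n.factorization p)) := by
    conv_lhs => rw [← Nat.prod_factorization_pow_eq_self hn.ne']
    rw [Finsupp.prod, Nat.support_factorization]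
    push_cast
    rw [← Real.finsetProd_rpow _ _ (fun i _ => by positivity)]
    refine Finset.prod_congr rfl fun p _ => ?_
    rw [← Real.rpow_natCast, ← Real.rpow_natCast, ← Real.rpow_mul (by positivity),
      ← Real.rpow_mul (by positivity), mul_comm]
  have h3 : ∏ p ∈ n.primeFactors, (if p < P then M else 1) ≤ M ^ P := by
    rw [← Finset.prod_filter, Finset.prod_const]
    apply pow_le_pow_right₀ hM1
    calc (n.primeFactors.filter (· < P)).card ≤ (Finset.range P).card := by
          apply Finset.card_le_card
          intro p hp
          simp only [Finset.mem_filter] at hp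
          simpa using hp.2
      _ = P := Finset.card_range P
  rw [h1, h2]
  calc ∏ p ∈ n.primeFactors, ((n.factorization p : ℝ) + 1)
      ≤ ∏ p ∈ n.primeFactors, ((if p < P then M else 1) * ((p : ℝ) ^ δ) ^ (n.factorization p)) := by
        apply Finset.prod_le_prod (fun i _ => by positivity)
        intro p hp
        have hp2 : (2 : ℝ) ≤ p := by exact_mod_cast (Nat.prime_of_mem_primeFactors hp).two_le
        generalize n.factorization p = e
        split_ifs with hlt
        · have h4 : 1 + x ≤ (p : ℝ) ^ δ := by
            calc 1 + x ≤ Real.exp x := by linarith [Real.add_one_le_exp x]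
              _ = (2 : ℝ) ^ δ := by rw [Real.rpow_def_of_pos (by norm_num), hx, mul_comm]
              _ ≤ (p : ℝ) ^ δ := Real.rpow_le_rpow (by norm_num) hp2 hδ.le
          have h5 : 1 + (e : ℝ) * x ≤ ((p : ℝ) ^ δ) ^ e :=
            (one_add_mul_le_pow (by linarith) e).trans
              (pow_le_pow_left₀ (by linarith) h4 e)
          have h6 : (e : ℝ) + 1 ≤ M * (1 + e * x) := by
            have : M * (1 + e * x) = 1 + 1 / x + e * x + e := by
              rw [hM]; field_simp; ring
            rw [this]
            have : 0 < 1 / x := by positivity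
            have : 0 ≤ e * x := by positivity
            linarith
          exact h6.trans (mul_le_mul_of_nonneg_left h5 (by linarith))
        · push Not at hlt
          have h4 : (2 : ℝ) ≤ (p : ℝ) ^ δ := by
            have : (2 : ℝ) ^ (1 / δ) ≤ p := (Nat.le_ceil _).trans (by exact_mod_cast hlt)
            calc (2 : ℝ) = ((2 : ℝ) ^ (1 / δ)) ^ δ := by
                  rw [← Real.rpow_mul (by norm_num), one_div_mul_cancel hδ.ne', Real.rpow_one]
              _ ≤ _ := Real.rpow_le_rpow (by positivity) this hδ.le
          rw [one_mul]
          calc (e : ℝ) + 1 ≤ 2 ^ e := by exact_mod_cast Nat.lt_two_pow_self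
            _ ≤ _ := pow_le_pow_left₀ (by norm_num) h4 e
    _ = (∏ p ∈ n.primeFactors, (if p < P then M else 1)) *
          ∏ p ∈ n.primeFactors, (((p : ℝ) ^ δ) ^ (n.factorization p)) := Finset.prod_mul_distrib
    _ ≤ _ := mul_le_mul_of_nonneg_right h3 (Finset.prod_nonneg fun i _ => by positivity)


/-- Structure of solutions. -/
lemma decomp (m n a b c : ℕ) (hn : 0 < n) (ha : 0 < a) (hb : 0 < b) (hc : 0 < c)
    (hab : a ≤ b) (hbc : b ≤ c)
    (h : m * (a * b * c) = n * (b * c + a * c + a * b)) :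
    ∃ d₁ d₂ d₃ z u v w : ℕ, d₁ ∣ n ∧ d₂ ∣ n ∧ d₃ ∣ n ∧ 0 < z ∧ 0 < u ∧ 0 < v ∧ 0 < w ∧
      a = n * (z * v * w) / d₁ ∧ b = n * (z * u * w) / d₂ ∧ c = n * (z * u * v) / d₃ ∧
      m * (z * u * v * w) = d₁ * u + d₂ * v + d₃ * w ∧
      d₂ * v ≤ d₁ * u ∧ d₃ * w ≤ d₂ * v ∧ Nat.Coprime w (Nat.gcd d₁ d₂) := by
  have key : ∀ x : ℕ, 0 < x → ∃ d t : ℕ, 0 < d ∧ 0 < t ∧ d ∣ n ∧ x * d = n * t ∧ Nat.Coprime d t := by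
    intro x hx
    obtain ⟨g, d, t, hg, hcop, h1, h2⟩ := Nat.exists_coprime' (Nat.gcd_pos_of_pos_left x hn)
    refine ⟨d, t, ?_, ?_, ⟨g, h1⟩, ?_, hcop⟩
    · rcases Nat.eq_zero_or_pos d with h | h
      · simp [h] at h1; omega
      · exact h
    · rcases Nat.eq_zero_or_pos t with h | h
      · simp [h] at h2; omega
      · exact h
    · rw [h1, h2]; ring
  obtain ⟨d₁, t₁, hd₁, ht₁, hdn₁, hat₁, hc₁⟩ := key a ha
  obtain ⟨d₂, t₂, hd₂, ht₂, hdn₂, hat₂, hc₂⟩ := key b hb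
  obtain ⟨d₃, t₃, hd₃, ht₃, hdn₃, hat₃, hc₃⟩ := key c hc
  have E : m * (t₁ * t₂ * t₃) = d₁ * (t₂ * t₃) + d₂ * (t₁ * t₃) + d₃ * (t₁ * t₂) := by
    have hpos : 0 < n * n * n := by positivity
    apply Nat.eq_of_mul_eq_mul_left hpos
    calc n * n * n * (m * (t₁ * t₂ * t₃)) = m * ((n * t₁) * (n * t₂) * (n * t₃)) := by ring
      _ = m * (a * b * c) * (d₁ * d₂ * d₃) := by rw [← hat₁, ← hat₂, ← hat₃]; ring
      _ = n * (d₁ * ((b * d₂) * (c * d₃)) + d₂ * ((a * d₁) * (c * d₃))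
            + d₃ * ((a * d₁) * (b * d₂))) := by rw [h]; ring
      _ = _ := by rw [hat₁, hat₂, hat₃]; ring
  have o12 : d₂ * t₁ ≤ d₁ * t₂ := by
    have : n * (d₂ * t₁) ≤ n * (d₁ * t₂) := by
      calc n * (d₂ * t₁) = a * (d₁ * d₂) := by rw [← mul_assoc, mul_comm n, mul_assoc, ← hat₁]; ring
        _ ≤ b * (d₁ * d₂) := Nat.mul_le_mul_right _ hab
        _ = n * (d₁ * t₂) := by
          rw [show b * (d₁ * d₂) = d₁ * (b * d₂) by ring, hat₂]; ring
    exact Nat.le_of_mul_le_mul_left this hn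
  have o23 : d₃ * t₂ ≤ d₂ * t₃ := by
    have : n * (d₃ * t₂) ≤ n * (d₂ * t₃) := by
      calc n * (d₃ * t₂) = b * (d₂ * d₃) := by rw [← mul_assoc, mul_comm n, mul_assoc, ← hat₂]; ring
        _ ≤ c * (d₂ * d₃) := Nat.mul_le_mul_right _ hbc
        _ = n * (d₂ * t₃) := by
          rw [show c * (d₂ * d₃) = d₂ * (c * d₃) by ring, hat₃]; ring
    exact Nat.le_of_mul_le_mul_left this hn
  set L := Nat.lcm (Nat.lcm t₁ t₂) t₃ with hL
  have hLpos : 0 < L := Nat.lcm_pos (Nat.lcm_pos ht₁ ht₂) ht₃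
  obtain ⟨u, hu⟩ : t₁ ∣ L := (Nat.dvd_lcm_left t₁ t₂).trans (Nat.dvd_lcm_left _ _)
  obtain ⟨v, hv⟩ : t₂ ∣ L := (Nat.dvd_lcm_right t₁ t₂).trans (Nat.dvd_lcm_left _ _)
  obtain ⟨w, hw⟩ : t₃ ∣ L := Nat.dvd_lcm_right _ _
  have hu0 : 0 < u := Nat.pos_of_ne_zero (by rintro rfl; omega)
  have hv0 : 0 < v := Nat.pos_of_ne_zero (by rintro rfl; omega)
  have hw0 : 0 < w := Nat.pos_of_ne_zero (by rintro rfl; omega)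
  -- no prime divides all of u, v, w
  have hno : ∀ p : ℕ, p.Prime → p ∣ u → p ∣ v → p ∣ w → False := by
    rintro p hp ⟨u', rfl⟩ ⟨v', rfl⟩ ⟨w', rfl⟩
    have hpL : L = p * (t₁ * u') := by rw [hu]; ring
    have h2 : t₂ * v' = t₁ * u' := by
      apply Nat.eq_of_mul_eq_mul_left hp.pos; rw [← hpL, hv]; ring
    have h3 : t₃ * w' = t₁ * u' := by
      apply Nat.eq_of_mul_eq_mul_left hp.pos; rw [← hpL, hw]; ring
    have : L ∣ t₁ * u' :=
      Nat.lcm_dvd (Nat.lcm_dvd ⟨u', rfl⟩ ⟨v', h2.symm⟩) ⟨w', h3.symm⟩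
    have hpos : 0 < t₁ * u' := Nat.pos_of_ne_zero (by rintro h; rw [h] at hpL; omega)
    have h4 := Nat.le_of_dvd hpos this
    have := hp.two_le
    rw [hpL] at h4
    nlinarith
  have EL : m * L = d₁ * u + d₂ * v + d₃ * w := by
    have hpos : 0 < t₁ * t₂ * t₃ := by positivity
    apply Nat.eq_of_mul_eq_mul_left hpos
    calc t₁ * t₂ * t₃ * (m * L) = (m * (t₁ * t₂ * t₃)) * L := by ring
      _ = d₁ * (t₂ * t₃) * L + d₂ * (t₁ * t₃) * L + d₃ * (t₁ * t₂) * L := by rw [E]; ring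
      _ = d₁ * (t₂ * t₃) * (t₁ * u) + d₂ * (t₁ * t₃) * (t₂ * v) + d₃ * (t₁ * t₂) * (t₃ * w) := by
        rw [← hu, ← hv, ← hw]
      _ = _ := by ring
  -- pairwise coprimality
  have cop : ∀ (x y q d t : ℕ), x ∣ L → L = t * q → Nat.Coprime d t →
      (∀ p : ℕ, p.Prime → p ∣ x → p ∣ y → p ∣ q → False) →
      (∃ e f, m * L = e * x + f * y + d * q) → Nat.Coprime x y := by
    rintro x y q d t hxL hLt hdt hno ⟨e, f, hef⟩
    apply Nat.Coprime.symm
    by_contra hcon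
    obtain ⟨p, hp, hpy, hpx⟩ := Nat.Prime.not_coprime_iff_dvd.mp hcon
    have hpq : ¬ p ∣ q := hno p hp hpx hpy
    have hpL : p ∣ L := hpx.trans hxL
    have hpt : p ∣ t := by
      rw [hLt] at hpL
      exact (hp.dvd_mul.mp hpL).resolve_right hpq
    have hpd : p ∣ d := by
      have h1 : p ∣ e * x + f * y + d * q := hef ▸ (hpL.mul_left m)
      have h2 : p ∣ e * x + f * y := (hpx.mul_left e).add (hpy.mul_left f)
      have h3 := (Nat.dvd_add_right h2).mp h1
      exact (hp.dvd_mul.mp h3).resolve_right hpq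
    have := Nat.eq_one_of_dvd_coprimes hdt hpd hpt
    exact hp.one_lt.ne' this
  have huL : u ∣ L := ⟨t₁, by rw [hu]; ring⟩
  have hvL : v ∣ L := ⟨t₂, by rw [hv]; ring⟩
  have hwL : w ∣ L := ⟨t₃, by rw [hw]; ring⟩
  have cuv : Nat.Coprime u v := cop u v w d₃ t₃ huL hw hc₃ hno ⟨d₁, d₂, EL⟩
  have cuw : Nat.Coprime u w := cop u w v d₂ t₂ huL hv hc₂
    (fun p hp h1 h2 h3 => hno p hp h1 h3 h2) ⟨d₁, d₃, by rw [EL]; ring⟩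
  have cvw : Nat.Coprime v w := cop v w u d₁ t₁ hvL hu hc₁
    (fun p hp h1 h2 h3 => hno p hp h3 h1 h2) ⟨d₂, d₃, by rw [EL]; ring⟩
  obtain ⟨z, hz⟩ : u * v * w ∣ L :=
    Nat.Coprime.mul_dvd_of_dvd_of_dvd (Nat.Coprime.mul_left cuw cvw)
      (Nat.Coprime.mul_dvd_of_dvd_of_dvd cuv huL hvL) hwL
  have hz0 : 0 < z := Nat.pos_of_ne_zero (by rintro rfl; omega)
  have e1 : t₁ = z * v * w := by
    apply Nat.eq_of_mul_eq_mul_right hu0; rw [← hu, hz]; ring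
  have e2 : t₂ = z * u * w := by
    apply Nat.eq_of_mul_eq_mul_right hv0; rw [← hv, hz]; ring
  have e3 : t₃ = z * u * v := by
    apply Nat.eq_of_mul_eq_mul_right hw0; rw [← hw, hz]; ring
  refine ⟨d₁, d₂, d₃, z, u, v, w, hdn₁, hdn₂, hdn₃, hz0, hu0, hv0, hw0, ?_, ?_, ?_, ?_, ?_, ?_, ?_⟩
  · rw [← e1, ← hat₁, Nat.mul_div_cancel _ hd₁]
  · rw [← e2, ← hat₂, Nat.mul_div_cancel _ hd₂]
  · rw [← e3, ← hat₃, Nat.mul_div_cancel _ hd₃]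
  · rw [← EL, hz]; ring
  · have : z * w * (d₂ * v) ≤ z * w * (d₁ * u) := by
      calc z * w * (d₂ * v) = d₂ * t₁ := by rw [e1]; ring
        _ ≤ d₁ * t₂ := o12
        _ = _ := by rw [e2]; ring
    exact Nat.le_of_mul_le_mul_left this (by positivity)
  · have : z * u * (d₃ * w) ≤ z * u * (d₂ * v) := by
      calc z * u * (d₃ * w) = d₃ * t₂ := by rw [e2]; ring
        _ ≤ d₂ * t₃ := o23
        _ = _ := by rw [e3]; ring
    exact Nat.le_of_mul_le_mul_left this (by positivity)
  · have h1 : Nat.Coprime d₂ w := Nat.Coprime.coprime_dvd_right ⟨z * u, by rw [e2]; ring⟩ hc₂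
    exact (Nat.Coprime.coprime_dvd_left (Nat.gcd_dvd_right d₁ d₂) h1).symm

lemma params (m n d₁ d₂ d₃ z u v w : ℕ) (hn : 0 < n) (h₁ : d₁ ∣ n) (h₂ : d₂ ∣ n)
    (hu : 0 < u) (hv : 0 < v) (hw : 0 < w)
    (E : m * (z * u * v * w) = d₁ * u + d₂ * v + d₃ * w)
    (o₁ : d₂ * v ≤ d₁ * u) (o₂ : d₃ * w ≤ d₂ * v) (hc : Nat.Coprime w (Nat.gcd d₁ d₂)) :
    ∃ r t : ℕ, 0 < r ∧ 0 < t ∧ r * u = d₂ * v + d₃ * w ∧ m * (z * v * w) = d₁ + r ∧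
      t * (Nat.gcd d₁ d₂ * w) = d₁ * u + d₂ * v ∧ m * (z * u * v) = d₃ + Nat.gcd d₁ d₂ * t ∧
      r * t * (z * w) ^ 2 * (v * w) * m ^ 2 ≤ 36 * n ^ 3 ∧ m ≤ 3 * n := by
  have hd₁ : 0 < d₁ := Nat.pos_of_dvd_of_pos h₁ hn
  have hd₂ : 0 < d₂ := Nat.pos_of_dvd_of_pos h₂ hn
  have hg : 0 < Nat.gcd d₁ d₂ := Nat.gcd_pos_of_pos_left _ hd₁
  have hl : d₁ * d₂ ≤ n * Nat.gcd d₁ d₂ := by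
    rw [← Nat.gcd_mul_lcm d₁ d₂, mul_comm]
    exact Nat.mul_le_mul_right _ (Nat.le_of_dvd hn (Nat.lcm_dvd h₁ h₂))
  obtain ⟨g₁, hg₁⟩ := Nat.gcd_dvd_left d₁ d₂
  obtain ⟨g₂, hg₂⟩ := Nat.gcd_dvd_right d₁ d₂
  have hd₁n : d₁ ≤ n := Nat.le_of_dvd hn h₁
  set g := Nat.gcd d₁ d₂ with hgdef
  have p1 : 0 < d₁ * u := by positivity
  have p2 : 0 < d₂ * v := by positivity
  -- r
  obtain ⟨r, hr⟩ : ∃ r, m * (z * v * w) = d₁ + r := by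
    apply Nat.exists_eq_add_of_le
    have : d₁ * u ≤ m * (z * v * w) * u := by
      calc d₁ * u ≤ m * (z * u * v * w) := by omega
        _ = _ := by ring
    exact Nat.le_of_mul_le_mul_right this hu
  have hru : r * u = d₂ * v + d₃ * w := by
    have : (d₁ + r) * u = d₁ * u + d₂ * v + d₃ * w := by rw [← hr, ← E]; ring
    rw [add_mul] at this; omega
  have hr0 : 0 < r := Nat.pos_of_ne_zero (by rintro rfl; omega)
  -- t
  obtain ⟨s, hs⟩ : ∃ s, m * (z * u * v) = d₃ + s := by
    apply Nat.exists_eq_add_of_le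
    have : d₃ * w ≤ m * (z * u * v) * w := by
      calc d₃ * w ≤ m * (z * u * v * w) := by omega
        _ = _ := by ring
    exact Nat.le_of_mul_le_mul_right this hw
  have hsw : s * w = d₁ * u + d₂ * v := by
    have : (d₃ + s) * w = d₁ * u + d₂ * v + d₃ * w := by rw [← hs, ← E]; ring
    rw [add_mul] at this; omega
  obtain ⟨t, ht⟩ : g ∣ s := by
    apply Nat.Coprime.dvd_of_dvd_mul_right hc.symm
    rw [hsw]
    exact ((Dvd.intro g₁ hg₁.symm).mul_right u).add ((Dvd.intro g₂ hg₂.symm).mul_right v)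
  have htw : t * (g * w) = d₁ * u + d₂ * v := by rw [← hsw, ht]; ring
  have ht0 : 0 < t := Nat.pos_of_ne_zero (by rintro rfl; omega)
  have hA : m * (z * v * w) ≤ 3 * d₁ := by
    have : m * (z * v * w) * u ≤ 3 * d₁ * u := by
      calc m * (z * v * w) * u = m * (z * u * v * w) := by ring
        _ ≤ 3 * (d₁ * u) := by omega
        _ = _ := by ring
    exact Nat.le_of_mul_le_mul_right this hu
  refine ⟨r, t, hr0, ht0, hru, hr, htw, by rw [hs, ht], ?_, ?_⟩
  · have hB : (r * u) * (t * (g * w)) ≤ (2 * (d₂ * v)) * (2 * (d₁ * u)) :=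
      Nat.mul_le_mul (by omega) (by omega)
    have hB' : r * t * g * w ≤ 4 * d₁ * d₂ * v := by
      have : r * t * g * w * u ≤ 4 * d₁ * d₂ * v * u := by
        calc r * t * g * w * u = (r * u) * (t * (g * w)) := by ring
          _ ≤ _ := hB
          _ = _ := by ring
      exact Nat.le_of_mul_le_mul_right this hu
    have : r * t * (z * w) ^ 2 * (v * w) * m ^ 2 * g ≤ 36 * n ^ 3 * g := by
      calc r * t * (z * w) ^ 2 * (v * w) * m ^ 2 * g
          = (r * t * g * w) * (z ^ 2 * w ^ 2 * v * m ^ 2) := by ring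
        _ ≤ (4 * d₁ * d₂ * v) * (z ^ 2 * w ^ 2 * v * m ^ 2) := Nat.mul_le_mul_right _ hB'
        _ = 4 * (d₁ * d₂) * (m * (z * v * w)) ^ 2 := by ring
        _ ≤ 4 * (n * g) * (3 * n) ^ 2 := by
          apply Nat.mul_le_mul (Nat.mul_le_mul_left _ hl)
          exact Nat.pow_le_pow_left (hA.trans (Nat.mul_le_mul_left _ hd₁n)) 2
        _ = _ := by ring
    exact Nat.le_of_mul_le_mul_right this hg
  · have hpos : 0 < z * v * w := by
      apply Nat.pos_of_ne_zero; intro h0; rw [h0] at hr; omega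
    calc m ≤ m * (z * v * w) := Nat.le_mul_of_pos_right _ hpos
      _ ≤ 3 * d₁ := hA
      _ ≤ 3 * n := Nat.mul_le_mul_left _ hd₁n

/-- The triple of denominators attached to parameters. -/
def solVec (n d₁ d₂ d₃ z u v w : ℕ) : Fin 3 → ℕ :=
  ![n * (z * v * w) / d₁, n * (z * u * w) / d₂, n * (z * u * v) / d₃]

/-- Solutions with `r = k`. -/
def famA (n d₁ d₂ d₃ k : ℕ) : Finset (Fin 3 → ℕ) :=
  ((d₁ + k).divisors ×ˢ (d₁ + k).divisors ×ˢ (d₁ + k).divisors).image fun x =>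
    solVec n d₁ d₂ d₃ x.1 ((d₂ * x.2.1 + d₃ * x.2.2) / k) x.2.1 x.2.2

/-- Solutions with `t = k`. -/
def famB (n d₁ d₂ d₃ k : ℕ) : Finset (Fin 3 → ℕ) :=
  ((d₃ + Nat.gcd d₁ d₂ * k).divisors ×ˢ (d₃ + Nat.gcd d₁ d₂ * k).divisors ×ˢ
    (d₃ + Nat.gcd d₁ d₂ * k).divisors).image fun x =>
    solVec n d₁ d₂ d₃ x.1 x.2.1 x.2.2 ((d₁ * x.2.1 + d₂ * x.2.2) / (k * Nat.gcd d₁ d₂))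

/-- Solutions with `z * w = k`. -/
def famC (m n d₁ d₂ d₃ k : ℕ) : Finset (Fin 3 → ℕ) :=
  (k.divisors ×ˢ k.divisors).biUnion fun y =>
    (d₁ * d₂ + m * y.1 * d₃ * y.2 ^ 2).divisors.image fun x =>
      solVec n d₁ d₂ d₃ y.1 ((x + d₂) / (m * y.1 * y.2))
        ((d₁ * ((x + d₂) / (m * y.1 * y.2)) + d₃ * y.2) / x) y.2

/-- Solutions with `v * w = k`. -/
def famD (m n d₁ d₂ d₃ k : ℕ) : Finset (Fin 3 → ℕ) :=
  (k.divisors ×ˢ k.divisors).biUnion fun y =>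
    (d₂ * y.1 + d₃ * y.2).divisors.image fun x =>
      solVec n d₁ d₂ d₃ ((d₁ * x + d₂ * y.1 + d₃ * y.2) / (m * (x * y.1 * y.2))) x y.1 y.2

/-- All the families together. -/
def famAll (m n K : ℕ) : Finset (Fin 3 → ℕ) :=
  (n.divisors ×ˢ n.divisors ×ˢ n.divisors).biUnion fun d =>
    (Finset.Icc 1 K).biUnion fun k =>
      (famA n d.1 d.2.1 d.2.2 k ∪ famB n d.1 d.2.1 d.2.2 k) ∪
        (famC m n d.1 d.2.1 d.2.2 k ∪ famD m n d.1 d.2.1 d.2.2 k)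

lemma mem_famAll (m n K a b c : ℕ) (hm : 0 < m) (hn : 0 < n) (ha : 0 < a) (hb : 0 < b) (hc : 0 < c)
    (hab : a ≤ b) (hbc : b ≤ c) (h : m * (a * b * c) = n * (b * c + a * c + a * b))
    (hK : ∀ r t p q : ℕ, r * t * p ^ 2 * q * m ^ 2 ≤ 36 * n ^ 3 → r ≤ K ∨ t ≤ K ∨ p ≤ K ∨ q ≤ K) :
    ![a, b, c] ∈ famAll m n K := by
  obtain ⟨d₁, d₂, d₃, z, u, v, w, h₁, h₂, h₃, hz, hu, hv, hw, ea, eb, ec, E, o₁, o₂, hcop⟩ :=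
    decomp m n a b c hn ha hb hc hab hbc h
  obtain ⟨r, t, hr0, ht0, hru, hr, htw, ht, hbd, -⟩ :=
    params m n d₁ d₂ d₃ z u v w hn h₁ h₂ hu hv hw E o₁ o₂ hcop
  have hd₁ : 0 < d₁ := Nat.pos_of_dvd_of_pos h₁ hn
  have hd₂ : 0 < d₂ := Nat.pos_of_dvd_of_pos h₂ hn
  have hg : 0 < Nat.gcd d₁ d₂ := Nat.gcd_pos_of_pos_left _ hd₁
  have hvec : ![a, b, c] = solVec n d₁ d₂ d₃ z u v w := by rw [solVec, ← ea, ← eb, ← ec]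
  simp only [famAll, Finset.mem_biUnion, Finset.mem_union, Finset.mem_product, Nat.mem_divisors,
    Finset.mem_Icc]
  refine ⟨(d₁, d₂, d₃), ⟨⟨h₁, hn.ne'⟩, ⟨h₂, hn.ne'⟩, ⟨h₃, hn.ne'⟩⟩, ?_⟩
  rcases hK _ _ _ _ hbd with hk | hk | hk | hk
  · refine ⟨r, ⟨hr0, hk⟩, Or.inl (Or.inl ?_)⟩
    simp only [famA, Finset.mem_image, Finset.mem_product, Nat.mem_divisors]
    refine ⟨(z, v, w), ⟨⟨⟨m * v * w, ?_⟩, by omega⟩, ⟨⟨m * z * w, ?_⟩, by omega⟩,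
      ⟨⟨m * z * v, ?_⟩, by omega⟩⟩, ?_⟩
    · rw [← hr]; ring
    · rw [← hr]; ring
    · rw [← hr]; ring
    · simp only
      rw [← hru, Nat.mul_div_cancel_left _ hr0, hvec]
  · refine ⟨t, ⟨ht0, hk⟩, Or.inl (Or.inr ?_)⟩
    have hne : d₃ + Nat.gcd d₁ d₂ * t ≠ 0 := by positivity
    simp only [famB, Finset.mem_image, Finset.mem_product, Nat.mem_divisors]
    refine ⟨(z, u, v), ⟨⟨⟨m * u * v, ?_⟩, hne⟩, ⟨⟨m * z * v, ?_⟩, hne⟩,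
      ⟨⟨m * z * u, ?_⟩, hne⟩⟩, ?_⟩
    · rw [← ht]; ring
    · rw [← ht]; ring
    · rw [← ht]; ring
    · simp only
      rw [← htw, ← mul_assoc, Nat.mul_div_cancel_left _ (by positivity), hvec]
  · refine ⟨z * w, ⟨Nat.mul_pos hz hw, hk⟩, Or.inr (Or.inl ?_)⟩
    have hne : z * w ≠ 0 := by positivity
    obtain ⟨x, hx⟩ : ∃ x, m * (z * u * w) = d₂ + x := by
      apply Nat.exists_eq_add_of_le
      have : d₂ * v ≤ m * (z * u * w) * v := by
        calc d₂ * v ≤ m * (z * u * v * w) := by rw [E]; nlinarith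
          _ = _ := by ring
      exact Nat.le_of_mul_le_mul_right this hv
    have hxv : x * v = d₁ * u + d₃ * w := by
      have : (d₂ + x) * v = d₁ * u + d₂ * v + d₃ * w := by rw [← hx, ← E]; ring
      rw [add_mul] at this; omega
    have hx0 : 0 < x := Nat.pos_of_ne_zero (by
      rintro rfl
      have : 0 < d₁ * u := by positivity
      omega)
    have hdu : (x + d₂) / (m * z * w) = u := by
      rw [add_comm, ← hx, show m * (z * u * w) = m * z * w * u by ring,
        Nat.mul_div_cancel_left _ (by positivity)]
    simp only [famC, Finset.mem_biUnion, Finset.mem_image, Finset.mem_product, Nat.mem_divisors]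
    refine ⟨(z, w), ⟨⟨⟨w, rfl⟩, hne⟩, ⟨⟨z, by ring⟩, hne⟩⟩, x, ⟨?_, by positivity⟩, ?_⟩
    · have : d₁ * x + (d₁ * d₂ + m * z * d₃ * w ^ 2) = x * (m * z * w * v) := by
        calc d₁ * x + (d₁ * d₂ + m * z * d₃ * w ^ 2)
            = d₁ * (d₂ + x) + m * z * d₃ * w ^ 2 := by ring
          _ = m * z * w * (d₁ * u + d₃ * w) := by rw [← hx]; ring
          _ = _ := by rw [← hxv]; ring
      exact (Nat.dvd_add_right (Dvd.intro_left d₁ rfl)).mp (this ▸ Dvd.intro _ rfl)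
    · simp only
      rw [hdu, ← hxv, Nat.mul_div_cancel_left _ hx0, hvec]
  · refine ⟨v * w, ⟨Nat.mul_pos hv hw, hk⟩, Or.inr (Or.inr ?_)⟩
    have hne : v * w ≠ 0 := by positivity
    simp only [famD, Finset.mem_biUnion, Finset.mem_image, Finset.mem_product, Nat.mem_divisors]
    refine ⟨(v, w), ⟨⟨⟨w, rfl⟩, hne⟩, ⟨⟨v, by ring⟩, hne⟩⟩, u, ⟨⟨r, ?_⟩, by positivity⟩, ?_⟩
    · rw [← hru]; ring
    · simp only
      rw [← E, show m * (z * u * v * w) = m * (u * v * w) * z by ring,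
        Nat.mul_div_cancel_left _ (by positivity), hvec]

lemma card_famAll (m n K T : ℕ) (hn : 0 < n) (hmn : m ≤ 3 * n) (hK : K ≤ 3 * n)
    (hT : ∀ N : ℕ, 0 < N → N ≤ 82 * n ^ 5 → N.divisors.card ≤ T) :
    (famAll m n K).card ≤ 4 * K * T ^ 6 := by
  have hT' : ∀ N : ℕ, N ≤ 82 * n ^ 5 → N.divisors.card ≤ T := by
    intro N hN
    rcases Nat.eq_zero_or_pos N with rfl | h
    · simp
    · exact hT N h hN
  have hn12 : n ≤ n ^ 2 := Nat.le_self_pow (by norm_num) n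
  have hn24 : n ^ 2 ≤ n ^ 5 := Nat.pow_le_pow_right hn (by norm_num)
  have hTn : n.divisors.card ≤ T := hT' n (by omega)
  have h3 : (n.divisors ×ˢ n.divisors ×ˢ n.divisors).card ≤ T ^ 3 := by
    rw [Finset.card_product, Finset.card_product]
    calc _ ≤ T * (T * T) := Nat.mul_le_mul hTn (Nat.mul_le_mul hTn hTn)
      _ = _ := by ring
  have main : ∀ d ∈ n.divisors ×ˢ n.divisors ×ˢ n.divisors, ∀ k ∈ Finset.Icc 1 K,
      ((famA n d.1 d.2.1 d.2.2 k ∪ famB n d.1 d.2.1 d.2.2 k) ∪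
        (famC m n d.1 d.2.1 d.2.2 k ∪ famD m n d.1 d.2.1 d.2.2 k)).card ≤ 4 * T ^ 3 := by
    rintro ⟨d₁, d₂, d₃⟩ hd k hk
    simp only [Finset.mem_product] at hd
    have h₁ : d₁ ≤ n := Nat.divisor_le hd.1
    have h₂ : d₂ ≤ n := Nat.divisor_le hd.2.1
    have h₃ : d₃ ≤ n := Nat.divisor_le hd.2.2
    have hd₁ : 0 < d₁ := Nat.pos_of_mem_divisors hd.1
    have hgn : Nat.gcd d₁ d₂ ≤ n := (Nat.gcd_le_left _ hd₁).trans h₁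
    rw [Finset.mem_Icc] at hk
    have hkn : k ≤ 3 * n := hk.2.trans hK
    have hkT : k.divisors.card ≤ T := hT' k (by omega)
    have hkk : (k.divisors ×ˢ k.divisors).card ≤ T ^ 2 := by
      rw [Finset.card_product, sq]; exact Nat.mul_le_mul hkT hkT
    have cA : (famA n d₁ d₂ d₃ k).card ≤ T ^ 3 := by
      refine Finset.card_image_le.trans ?_
      rw [Finset.card_product, Finset.card_product]
      have := hT' (d₁ + k) (by omega)
      calc _ ≤ T * (T * T) := Nat.mul_le_mul this (Nat.mul_le_mul this this)
        _ = _ := by ring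
    have cB : (famB n d₁ d₂ d₃ k).card ≤ T ^ 3 := by
      refine Finset.card_image_le.trans ?_
      rw [Finset.card_product, Finset.card_product]
      have := hT' (d₃ + Nat.gcd d₁ d₂ * k) (by
        have : Nat.gcd d₁ d₂ * k ≤ n * (3 * n) := Nat.mul_le_mul hgn hkn
        nlinarith)
      calc _ ≤ T * (T * T) := Nat.mul_le_mul this (Nat.mul_le_mul this this)
        _ = _ := by ring
    have cC : (famC m n d₁ d₂ d₃ k).card ≤ T ^ 3 := by
      refine (Finset.card_biUnion_le_card_mul _ _ T ?_).trans
        ((Nat.mul_le_mul_right T hkk).trans (by rw [pow_succ T 2]))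
      rintro ⟨z, w⟩ hzw
      simp only [Finset.mem_product] at hzw
      refine Finset.card_image_le.trans (hT' _ ?_)
      have e1 : z ≤ 3 * n := (Nat.divisor_le hzw.1).trans hkn
      have e2 : w ≤ 3 * n := (Nat.divisor_le hzw.2).trans hkn
      have e3 : d₁ * d₂ ≤ n * n := Nat.mul_le_mul h₁ h₂
      have e4 : m * z * d₃ * w ^ 2 ≤ 3 * n * (3 * n) * n * (3 * n) ^ 2 := by gcongr
      have e5 : 3 * n * (3 * n) * n * (3 * n) ^ 2 = 81 * n ^ 5 := by ring
      simp only
      nlinarith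
    have cD : (famD m n d₁ d₂ d₃ k).card ≤ T ^ 3 := by
      refine (Finset.card_biUnion_le_card_mul _ _ T ?_).trans
        ((Nat.mul_le_mul_right T hkk).trans (by rw [pow_succ T 2]))
      rintro ⟨v, w⟩ hvw
      simp only [Finset.mem_product] at hvw
      have e1 : v ≤ 3 * n := (Nat.divisor_le hvw.1).trans hkn
      have e2 : w ≤ 3 * n := (Nat.divisor_le hvw.2).trans hkn
      refine Finset.card_image_le.trans (hT' _ ?_)
      have e3 : d₂ * v ≤ n * (3 * n) := Nat.mul_le_mul h₂ e1
      have e4 : d₃ * w ≤ n * (3 * n) := Nat.mul_le_mul h₃ e2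
      simp only
      nlinarith
    have q1 := Finset.card_union_le (famA n d₁ d₂ d₃ k ∪ famB n d₁ d₂ d₃ k)
      (famC m n d₁ d₂ d₃ k ∪ famD m n d₁ d₂ d₃ k)
    have q2 := Finset.card_union_le (famA n d₁ d₂ d₃ k) (famB n d₁ d₂ d₃ k)
    have q3 := Finset.card_union_le (famC m n d₁ d₂ d₃ k) (famD m n d₁ d₂ d₃ k)
    simp only
    omega
  calc (famAll m n K).card ≤ (n.divisors ×ˢ n.divisors ×ˢ n.divisors).card * (K * (4 * T ^ 3)) := by
        refine Finset.card_biUnion_le_card_mul _ _ _ fun d hd => ?_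
        refine (Finset.card_biUnion_le_card_mul _ _ _ (main d hd)).trans ?_
        simp
    _ ≤ T ^ 3 * (K * (4 * T ^ 3)) := Nat.mul_le_mul_right _ h3
    _ = _ := by ring

theorem stmt_0 : ∀ ε : ℝ, 0 < ε → ∃ C : ℝ, 0 < C ∧
    ∀ m n : ℕ, 0 < m → 0 < n →
      (numSols 3 m n : ℝ) ≤ C * (n : ℝ) ^ ε * ((n : ℝ) ^ 3 / (m : ℝ) ^ 2) ^ ((1 : ℝ) / 5) := by
  intro ε hε
  obtain ⟨C₀, hC₀, hdiv⟩ := divisor_bound (ε / 30) (by positivity)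
  set δ := ε / 30 with hδ
  have hδ0 : 0 < δ := by positivity
  refine ⟨4 * (36 : ℝ) ^ ((1 : ℝ) / 5) * (C₀ * (82 : ℝ) ^ δ) ^ 6, by positivity, ?_⟩
  intro m n hm hn
  have hmR : (0 : ℝ) < m := by exact_mod_cast hm
  have hnR : (0 : ℝ) < n := by exact_mod_cast hn
  have hm1 : (1 : ℝ) ≤ m := by exact_mod_cast hm
  have hn1 : (1 : ℝ) ≤ n := by exact_mod_cast hn
  set Q : ℝ := (n : ℝ) ^ 3 / (m : ℝ) ^ 2 with hQ
  have hQ0 : 0 < Q := by positivity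
  set B : ℝ := (36 * Q) ^ ((1 : ℝ) / 5) with hB
  have hB0 : 0 < B := by positivity
  have hB5 : B ^ 5 = 36 * Q := by
    rw [hB, ← Real.rpow_natCast, ← Real.rpow_mul (by positivity)]
    norm_num
  set K : ℕ := ⌊B⌋₊ with hKdef
  have hKB : (K : ℝ) ≤ B := Nat.floor_le hB0.le
  have hlt : ∀ x : ℕ, K < x → B < x := fun x hx => (Nat.floor_lt hB0.le).mp hx
  have hK3 : K ≤ 3 * n := by
    have h1 : B ≤ 3 * n := by
      apply le_of_pow_le_pow_left₀ (n := 5) (by norm_num) (by positivity)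
      rw [hB5]
      have : Q ≤ (n : ℝ) ^ 3 := div_le_self (by positivity) (one_le_pow₀ hm1)
      have h35 : (n : ℝ) ^ 3 ≤ (n : ℝ) ^ 5 := pow_le_pow_right₀ hn1 (by norm_num)
      nlinarith
    exact_mod_cast hKB.trans h1
  have hK : ∀ r t p q : ℕ, r * t * p ^ 2 * q * m ^ 2 ≤ 36 * n ^ 3 →
      r ≤ K ∨ t ≤ K ∨ p ≤ K ∨ q ≤ K := by
    intro r t p q h
    by_contra! hcon
    obtain ⟨h1, h2, h3, h4⟩ := hcon
    have h1 := hlt _ h1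
    have h2 := hlt _ h2
    have h3 := hlt _ h3
    have h4 := hlt _ h4
    have hR : (r : ℝ) * t * p ^ 2 * q * m ^ 2 ≤ 36 * n ^ 3 := by exact_mod_cast h
    have hR' : (r : ℝ) * t * p ^ 2 * q ≤ B ^ 5 := by
      rw [hB5, hQ, mul_div_assoc', le_div_iff₀ (by positivity)]
      exact hR
    have : B ^ 5 < (r : ℝ) * t * p ^ 2 * q := by
      calc B ^ 5 = B * B * B ^ 2 * B := by ring
        _ < (r : ℝ) * t * p ^ 2 * q := by gcongr
    linarith
  set T : ℕ := ⌊C₀ * (82 * (n : ℝ) ^ 5) ^ δ⌋₊ with hTdef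
  have hT : ∀ N : ℕ, 0 < N → N ≤ 82 * n ^ 5 → N.divisors.card ≤ T := by
    intro N hN hNn
    apply Nat.le_floor
    refine (hdiv N hN).trans ?_
    have : (N : ℝ) ≤ 82 * (n : ℝ) ^ 5 := by exact_mod_cast hNn
    gcongr
  have hTR : (T : ℝ) ≤ C₀ * (82 * (n : ℝ) ^ 5) ^ δ := Nat.floor_le (by positivity)
  have hconv : ∀ a : Fin 3 → ℕ, ((∀ i, 0 < a i) ∧ Monotone a ∧
      (m : ℚ) / n = ∑ i, (1 : ℚ) / a i) →
      a 0 ≤ a 1 ∧ a 1 ≤ a 2 ∧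
      m * (a 0 * a 1 * a 2) = n * (a 1 * a 2 + a 0 * a 2 + a 0 * a 1) := by
    rintro a ⟨hp, hmono, he⟩
    refine ⟨hmono (by decide), hmono (by decide), ?_⟩
    rw [Fin.sum_univ_three] at he
    have h0 : (a 0 : ℚ) ≠ 0 := by exact_mod_cast (hp 0).ne'
    have h1 : (a 1 : ℚ) ≠ 0 := by exact_mod_cast (hp 1).ne'
    have h2 : (a 2 : ℚ) ≠ 0 := by exact_mod_cast (hp 2).ne'
    have hnQ : (n : ℚ) ≠ 0 := by exact_mod_cast hn.ne'
    field_simp at he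
    have : (m : ℚ) * (a 0 * a 1 * a 2) = n * (a 1 * a 2 + a 0 * a 2 + a 0 * a 1) := by
      linarith
    exact_mod_cast this
  have hnum : numSols 3 m n ≤ 4 * K * T ^ 6 := by
    by_cases hmn : m ≤ 3 * n
    · refine le_trans ?_ (card_famAll m n K T hn hmn hK3 hT)
      have hsub : {a : Fin 3 → ℕ | (∀ i, 0 < a i) ∧ Monotone a ∧
          (m : ℚ) / n = ∑ i, (1 : ℚ) / a i} ⊆ (famAll m n K : Set (Fin 3 → ℕ)) := by
        intro a ha
        obtain ⟨h01, h12, h⟩ := hconv a ha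
        have := mem_famAll m n K (a 0) (a 1) (a 2) hm hn (ha.1 0) (ha.1 1) (ha.1 2) h01 h12 h hK
        have hv : ![a 0, a 1, a 2] = a := by
          ext i; fin_cases i <;> rfl
        rw [hv] at this
        exact this
      have := Set.ncard_le_ncard hsub (Finset.finite_toSet _)
      rw [Set.ncard_coe_finset] at this
      exact this
    · have : IsEmpty {a : Fin 3 → ℕ // (∀ i, 0 < a i) ∧ Monotone a ∧
          (m : ℚ) / n = ∑ i, (1 : ℚ) / a i} := by
        refine ⟨fun ⟨a, ha⟩ => hmn ?_⟩
        obtain ⟨h01, h12, h⟩ := hconv a ha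
        obtain ⟨d₁, d₂, d₃, z, u, v, w, h₁, h₂, h₃, hz, hu, hv, hw, ea, eb, ec, E, o₁, o₂, hcop⟩ :=
          decomp m n _ _ _ hn (ha.1 0) (ha.1 1) (ha.1 2) h01 h12 h
        obtain ⟨r, t, -, -, -, -, -, -, -, hfin⟩ :=
          params m n d₁ d₂ d₃ z u v w hn h₁ h₂ hu hv hw E o₁ o₂ hcop
        exact hfin
      rw [numSols, Nat.card_of_isEmpty]
      exact Nat.zero_le _
  have hBeq : B = (36 : ℝ) ^ ((1 : ℝ) / 5) * Q ^ ((1 : ℝ) / 5) := by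
    rw [hB, Real.mul_rpow (by norm_num) hQ0.le]
  have hTeq : (C₀ * (82 * (n : ℝ) ^ 5) ^ δ) ^ 6 = (C₀ * (82 : ℝ) ^ δ) ^ 6 * (n : ℝ) ^ ε := by
    rw [Real.mul_rpow (by norm_num) (by positivity), ← mul_assoc, mul_pow _ _ 6]
    congr 1
    rw [← Real.rpow_natCast, ← Real.rpow_natCast, ← Real.rpow_mul hnR.le, ← Real.rpow_mul hnR.le]
    congr 1
    rw [hδ]; push_cast; ring
  calc (numSols 3 m n : ℝ) ≤ 4 * K * T ^ 6 := by exact_mod_cast hnum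
    _ ≤ 4 * B * (C₀ * (82 * (n : ℝ) ^ 5) ^ δ) ^ 6 := by gcongr
    _ = _ := by rw [hTeq, hBeq]; ring
end

section
/- For every ε > 0 there exists a constant C = C(ε) > 0 such that for all positive integers m and n, f₄(m,n) ≤ C · n^ε · ( n^(4/3)/m^(2/3) + n^(28/17)/m^(8/5) ). -/
/-- Divisor bound. -/
lemma divisor_bound_s2 (ε : ℝ) (hε : 0 < ε) : ∃ C : ℝ, 0 < C ∧ ∀ k : ℕ, k ≠ 0 →
    (k.divisors.card : ℝ) ≤ C * (k : ℝ) ^ ε := by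
  set K : ℝ := 1 + 1 / (ε * Real.log 2) with hK
  have hl2 : 0 < Real.log 2 := Real.log_pos (by norm_num)
  have hK1 : 1 ≤ K := by
    have : 0 < 1 / (ε * Real.log 2) := by positivity
    linarith
  set P : ℕ := ⌈(2 : ℝ) ^ (1 / ε)⌉₊ with hP
  refine ⟨K ^ P, by positivity, ?_⟩
  intro k hk
  rw [Nat.card_divisors hk]
  have hkprod : (k : ℝ) ^ ε = ∏ p ∈ k.primeFactors, ((p : ℝ) ^ (k.factorization p)) ^ ε := by
    conv_lhs => rw [← Nat.prod_factorization_pow_eq_self hk]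
    rw [Finsupp.prod, Nat.support_factorization]
    push_cast
    rw [← Real.finsetProd_rpow]
    intros; positivity
  have hterm : ∀ p ∈ k.primeFactors, ((k.factorization p + 1 : ℕ) : ℝ) ≤
      (if p < P then K else 1) * ((p : ℝ) ^ (k.factorization p)) ^ ε := by
    intro p hp
    have hp2 : 2 ≤ p := (Nat.prime_of_mem_primeFactors hp).two_le
    have hp2' : (2 : ℝ) ≤ p := by exact_mod_cast hp2
    set e := k.factorization p
    have hsw : ((p : ℝ) ^ e) ^ ε = ((p : ℝ) ^ ε) ^ e := by
      rw [← Real.rpow_natCast, ← Real.rpow_natCast, ← Real.rpow_mul (by positivity),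
        ← Real.rpow_mul (by positivity), mul_comm]
    split_ifs with h
    · have h1 : (2 : ℝ) ^ ((e : ℝ) * ε) ≤ ((p : ℝ) ^ e) ^ ε := by
        rw [← Real.rpow_natCast, ← Real.rpow_mul (by positivity)]
        exact Real.rpow_le_rpow (by norm_num) hp2' (by positivity)
      have h2 : 1 + (e : ℝ) * (ε * Real.log 2) ≤ (2 : ℝ) ^ ((e : ℝ) * ε) := by
        rw [Real.rpow_def_of_pos (by norm_num)]
        have := Real.add_one_le_exp (Real.log 2 * ((e : ℝ) * ε))
        nlinarith
      have h3 : ((e : ℝ) + 1) ≤ K * (1 + (e : ℝ) * (ε * Real.log 2)) := by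
        have hx : 0 < ε * Real.log 2 := by positivity
        have : K * (1 + (e : ℝ) * (ε * Real.log 2)) =
          1 + 1 / (ε * Real.log 2) + e * (ε * Real.log 2) + e := by
          rw [hK]; field_simp; ring
        rw [this]
        have : 0 ≤ 1 / (ε * Real.log 2) := by positivity
        have : 0 ≤ e * (ε * Real.log 2) := by positivity
        linarith
      push_cast
      calc ((e : ℝ) + 1) ≤ _ := h3
        _ ≤ _ := by gcongr; exact h2.trans h1
    · have hPp : (2 : ℝ) ^ (1 / ε) ≤ p := by
        push Not at h
        calc _ ≤ (P : ℝ) := Nat.le_ceil _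
          _ ≤ p := by exact_mod_cast h
      have h2 : (2 : ℝ) ≤ (p : ℝ) ^ ε := by
        calc (2 : ℝ) = ((2 : ℝ) ^ (1 / ε)) ^ ε := by
              rw [← Real.rpow_mul (by norm_num)]; field_simp; simp
          _ ≤ _ := Real.rpow_le_rpow (by positivity) hPp hε.le
      rw [one_mul, hsw]
      calc ((e + 1 : ℕ) : ℝ) ≤ ((2 ^ e : ℕ) : ℝ) := by exact_mod_cast Nat.lt_two_pow_self
        _ = (2 : ℝ) ^ e := by push_cast; rfl
        _ ≤ _ := by gcongr
  rw [hkprod]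
  push_cast
  calc ∏ p ∈ k.primeFactors, ((k.factorization p : ℝ) + 1)
      ≤ ∏ p ∈ k.primeFactors, (if p < P then K else 1) * ((p : ℝ) ^ (k.factorization p)) ^ ε := by
        apply Finset.prod_le_prod
        · intros; positivity
        · intro p hp; have := hterm p hp; push_cast at this; exact this
    _ = (∏ p ∈ k.primeFactors, (if p < P then K else 1)) *
          ∏ p ∈ k.primeFactors, ((p : ℝ) ^ (k.factorization p)) ^ ε := Finset.prod_mul_distrib
    _ ≤ _ := by
        gcongr
        rw [← Finset.prod_filter, Finset.prod_const]
        apply pow_le_pow_right₀ hK1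
        calc _ ≤ (Finset.range P).card := by
              apply Finset.card_le_card
              intro p hp
              simp at hp ⊢
              exact hp.2
          _ = P := by simp

set_option linter.unusedSimpArgs false in
set_option maxHeartbeats 4000000 in
/-- relative gcd decomposition -/
lemma rel_gcd (t1 t2 t3 t4 : ℕ) (h1 : t1 ≠ 0) (h2 : t2 ≠ 0) (h3 : t3 ≠ 0) (h4 : t4 ≠ 0)
    (d1 : t1 ∣ Nat.lcm t2 (Nat.lcm t3 t4)) (d2 : t2 ∣ Nat.lcm t1 (Nat.lcm t3 t4))
    (d3 : t3 ∣ Nat.lcm t1 (Nat.lcm t2 t4)) (d4 : t4 ∣ Nat.lcm t1 (Nat.lcm t2 t3)) :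
    ∃ x12 x13 x14 x23 x24 x34 x123 x124 x134 x234 x1234 : ℕ,
      t1 = x12 * x13 * x14 * x123 * x124 * x134 * x1234 ∧
      t2 = x12 * x23 * x24 * x123 * x124 * x234 * x1234 ∧
      t3 = x13 * x23 * x34 * x123 * x134 * x234 * x1234 ∧
      t4 = x14 * x24 * x34 * x124 * x134 * x234 * x1234 := by
  have key2 : ∀ a b c d : ℕ, a ≠ 0 → b ≠ 0 → c ≠ 0 → d ≠ 0 →
      ∃ x : ℕ, x ≠ 0 ∧ ∀ p, x.factorization p = min (a.factorization p) (b.factorization p) -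
        max (c.factorization p) (d.factorization p) := by
    intro a b c d ha hb hc hd
    have hg : Nat.gcd a b ≠ 0 := Nat.gcd_ne_zero_left ha
    have hl : Nat.lcm c d ≠ 0 := Nat.lcm_ne_zero hc hd
    have hd : Nat.gcd (Nat.gcd a b) (Nat.lcm c d) ∣ Nat.gcd a b := Nat.gcd_dvd_left _ _
    refine ⟨Nat.gcd a b / Nat.gcd (Nat.gcd a b) (Nat.lcm c d), ?_, ?_⟩
    · exact (Nat.div_pos (Nat.le_of_dvd (Nat.pos_of_ne_zero hg) hd)
        (Nat.gcd_pos_of_pos_left _ (Nat.pos_of_ne_zero hg))).ne'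
    · intro p
      rw [Nat.factorization_div hd, Nat.factorization_gcd hg hl, Nat.factorization_gcd ha hb,
        Nat.factorization_lcm hc (by assumption)]
      simp only [Finsupp.coe_tsub, Pi.sub_apply, Finsupp.inf_apply, Finsupp.sup_apply]
      omega
  have key3 : ∀ a b c d : ℕ, a ≠ 0 → b ≠ 0 → c ≠ 0 → d ≠ 0 →
      ∃ x : ℕ, x ≠ 0 ∧ ∀ p, x.factorization p = min (a.factorization p) (min (b.factorization p)
        (c.factorization p)) - (d.factorization p) := by
    intro a b c d ha hb hc hd
    have hg : Nat.gcd b c ≠ 0 := Nat.gcd_ne_zero_left hb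
    obtain ⟨x, hx, h⟩ := key2 a (Nat.gcd b c) d d ha hg hd hd
    refine ⟨x, hx, fun p => ?_⟩
    rw [h, Nat.factorization_gcd hb hc]
    simp
  obtain ⟨x12, n12, e12⟩ := key2 t1 t2 t3 t4 h1 h2 h3 h4
  obtain ⟨x13, n13, e13⟩ := key2 t1 t3 t2 t4 h1 h3 h2 h4
  obtain ⟨x14, n14, e14⟩ := key2 t1 t4 t2 t3 h1 h4 h2 h3
  obtain ⟨x23, n23, e23⟩ := key2 t2 t3 t1 t4 h2 h3 h1 h4
  obtain ⟨x24, n24, e24⟩ := key2 t2 t4 t1 t3 h2 h4 h1 h3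
  obtain ⟨x34, n34, e34⟩ := key2 t3 t4 t1 t2 h3 h4 h1 h2
  obtain ⟨x123, n123, e123⟩ := key3 t1 t2 t3 t4 h1 h2 h3 h4
  obtain ⟨x124, n124, e124⟩ := key3 t1 t2 t4 t3 h1 h2 h4 h3
  obtain ⟨x134, n134, e134⟩ := key3 t1 t3 t4 t2 h1 h3 h4 h2
  obtain ⟨x234, n234, e234⟩ := key3 t2 t3 t4 t1 h2 h3 h4 h1
  obtain ⟨x1234, n1234, e1234⟩ := key3 t1 t2 (Nat.gcd t3 t4) 1 h1 h2 (Nat.gcd_ne_zero_left h3)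
    one_ne_zero
  rw [← Nat.factorization_le_iff_dvd (by assumption)
    (Nat.lcm_ne_zero (by assumption) (Nat.lcm_ne_zero (by assumption) (by assumption))),
    Nat.factorization_lcm (by assumption) (Nat.lcm_ne_zero (by assumption) (by assumption)),
    Nat.factorization_lcm (by assumption) (by assumption)] at d1 d2 d3 d4
  rw [Nat.factorization_gcd h3 h4] at e1234
  simp only [Nat.factorization_one, Finsupp.coe_zero, Pi.zero_apply, Finsupp.inf_apply] at e1234
  refine ⟨x12, x13, x14, x23, x24, x34, x123, x124, x134, x234, x1234, ?_, ?_, ?_, ?_⟩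
  all_goals
    apply Nat.eq_of_factorization_eq (by assumption) (by simp [*])
    intro p
    have d1' := d1 p
    have d2' := d2 p
    have d3' := d3 p
    have d4' := d4 p
    rw [Nat.factorization_mul (by simp [*]) (by assumption),
      Nat.factorization_mul (by simp [*]) (by assumption),
      Nat.factorization_mul (by simp [*]) (by assumption),
      Nat.factorization_mul (by simp [*]) (by assumption),
      Nat.factorization_mul (by simp [*]) (by assumption),
      Nat.factorization_mul (by assumption) (by assumption)]
    simp only [Finsupp.coe_add, Pi.add_apply, Finsupp.sup_apply] at *
    rw [e1234]
    simp only [e12, e13, e14, e23, e24, e34, e123, e124, e134, e234]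
    generalize t1.factorization p = v1 at *
    generalize t2.factorization p = v2 at *
    generalize t3.factorization p = v3 at *
    generalize t4.factorization p = v4 at *
    clear d1 d2 d3 d4 e12 e13 e14 e23 e24 e34 e123 e124 e134 e234 e1234
    rcases le_total v1 v2 with a1 | a1 <;> rcases le_total v3 v4 with a2 | a2 <;>
    rcases le_total v1 v3 with a3 | a3 <;> rcases le_total v2 v4 with a4 | a4 <;>
    rcases le_total v1 v4 with a5 | a5 <;> rcases le_total v2 v3 with a6 | a6 <;>
      simp only [min_eq_left, min_eq_right, max_eq_left, max_eq_right, a1, a2, a3, a4, a5, a6]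
        at d1' d2' d3' d4' ⊢ <;>
    omega

/-- any finite family satisfying `p` has at most `K` members -/
def CB {W : Type} (p : W → Prop) (K : ℕ) : Prop :=
  ∀ T : Finset W, (∀ w ∈ T, p w) → T.card ≤ K

lemma CB.mono {W : Type} {p : W → Prop} {K K' : ℕ} (h : CB p K) (hK : K ≤ K') : CB p K' :=
  fun T hT => (h T hT).trans hK

lemma CB_one {W : Type} {p : W → Prop} (h : ∀ w w', p w → p w' → w = w') : CB p 1 :=
  fun _ hT => Finset.card_le_one.2 fun a ha b hb => h a b (hT a ha) (hT b hb)

lemma CB_fib {W β : Type} {p : W → Prop} {K : ℕ} (g : W → β) (U : Finset β)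
    (hg : ∀ w, p w → g w ∈ U)
    (h : ∀ w₀, p w₀ → CB (fun w => p w ∧ g w = g w₀) K) : CB p (U.card * K) := by
  classical
  intro T hT
  rw [mul_comm]
  refine Finset.card_le_mul_card_image_of_maps_to (f := g) (fun w hw => hg w (hT w hw)) K ?_
  intro b _
  by_cases hb : ∃ w₀ ∈ T, g w₀ = b
  · obtain ⟨w₀, h0, rfl⟩ := hb
    apply h w₀ (hT w₀ h0)
    intro w hw
    rw [Finset.mem_filter] at hw
    exact ⟨hT w hw.1, hw.2⟩
  · rw [Finset.filter_eq_empty_iff.2]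
    · simp
    · intro w hw h'
      exact hb ⟨w, hw, h'⟩

lemma CB_key {W : Type} {p : W → Prop} {K B : ℕ} (v : W → ℕ)
    (hv : ∀ w, p w → 0 < v w ∧ v w ≤ B)
    (h : ∀ w₀, p w₀ → CB (fun w => p w ∧ v w = v w₀) K) : CB p (B * K) := by
  have := CB_fib v (Finset.Icc 1 B) (fun w hw => by
    have := hv w hw
    simp; omega) h
  simpa using this

lemma CB_vec {W : Type} {p : W → Prop} {K D M r : ℕ} (hD : ∀ k, k ≠ 0 → k ≤ M → k.divisors.card ≤ D)
    (g : W → Fin r → ℕ) (F : Fin r → ℕ) (hF : ∀ i, F i ≠ 0 ∧ F i ≤ M)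
    (hg : ∀ w, p w → ∀ i, g w i ∣ F i)
    (h : ∀ w₀, p w₀ → CB (fun w => p w ∧ g w = g w₀) K) : CB p (D ^ r * K) := by
  have := CB_fib g (Fintype.piFinset fun i => (F i).divisors) (fun w hw => by
    rw [Fintype.mem_piFinset]
    intro i
    exact Nat.mem_divisors.2 ⟨hg w hw i, (hF i).1⟩) h
  refine this.mono (Nat.mul_le_mul_right _ ?_)
  rw [Fintype.card_piFinset]
  calc _ ≤ ∏ i : Fin r, D := Finset.prod_le_prod' fun i _ => hD _ (hF i).1 (hF i).2
    _ = _ := by simp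

lemma CB_bil {W : Type} {p : W → Prop} {D M V : ℕ} (hD : ∀ k, k ≠ 0 → k ≤ M → k.divisors.card ≤ D)
    (hM : 2 * V ^ 2 ≤ M) (y z : W → ℕ) (a q b c d : ℕ) (hd : 0 < d)
    (hp : ∀ w, p w → 0 < y w ∧ 0 < z w ∧
      a * (y w * z w) = q * (y w * z w) + b * y w + c * z w + d ∧ a * (y w * z w) ≤ V)
    (h : ∀ w w', p w → p w' → y w = y w' → z w = z w' → w = w') : CB p D := by
  intro T hT
  rcases T.eq_empty_or_nonempty with rfl | ⟨w₀, hw₀⟩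
  · simp
  have hqa : q < a := by
    obtain ⟨h1, h2, h3, -⟩ := hp w₀ (hT _ hw₀)
    by_contra hc
    push Not at hc
    have := Nat.mul_le_mul_right (y w₀ * z w₀) hc
    omega
  obtain ⟨A, rfl⟩ := Nat.exists_eq_add_of_lt hqa
  set A' := A + 1 with hA'
  have hpos : 0 < A' * d + b * c := by positivity
  have main : ∀ w, p w → ∃ s, 0 < s ∧ A' * y w = c + s ∧ s * z w = b * y w + d ∧
      s ∣ A' * d + b * c := by
    intro w hw
    obtain ⟨h1, h2, h3, -⟩ := hp w hw
    have h4 : A' * y w * z w = b * y w + c * z w + d := by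
      have : (q + A + 1) * (y w * z w) = q * (y w * z w) + A' * y w * z w := by rw [hA']; ring
      omega
    have h5 : c < A' * y w := by
      by_contra hc
      push Not at hc
      have := Nat.mul_le_mul_right (z w) hc
      omega
    obtain ⟨s, hs⟩ := Nat.exists_eq_add_of_lt h5
    refine ⟨s + 1, by omega, by omega, ?_, ?_⟩
    · have : A' * y w * z w = c * z w + (s + 1) * z w := by rw [hs]; ring
      omega
    · have hz : (s + 1) * z w = b * y w + d := by
        have : A' * y w * z w = c * z w + (s + 1) * z w := by rw [hs]; ring
        omega
      have e : (s + 1) * (A' * z w) = (s + 1) * b + (A' * d + b * c) := by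
        calc (s + 1) * (A' * z w) = A' * ((s + 1) * z w) := by ring
          _ = b * (A' * y w) + A' * d := by rw [hz]; ring
          _ = _ := by rw [hs]; ring
      exact (Nat.dvd_add_right (dvd_mul_right (s + 1) b)).1 (e ▸ dvd_mul_right _ _)
  have hle : A' * d + b * c ≤ M := by
    obtain ⟨h1, h2, h3, h4⟩ := hp w₀ (hT _ hw₀)
    have hyz : 1 ≤ y w₀ * z w₀ := Nat.mul_pos h1 h2
    have ha : A' ≤ V := by
      calc A' ≤ (q + A + 1) * 1 := by omega
        _ ≤ (q + A + 1) * (y w₀ * z w₀) := by gcongr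
        _ ≤ V := h4
    have hb : b ≤ b * y w₀ := Nat.le_mul_of_pos_right _ h1
    have hc : c ≤ c * z w₀ := Nat.le_mul_of_pos_right _ h2
    calc A' * d + b * c ≤ V * V + V * V := by gcongr <;> omega
      _ = 2 * V ^ 2 := by ring
      _ ≤ M := hM
  refine le_trans ?_ (hD _ hpos.ne' hle)
  apply Finset.card_le_card_of_injOn (fun w => A' * y w - c)
  · intro w hw
    obtain ⟨s, hs, h1, h2, h3⟩ := main w (hT w hw)
    simp only [Finset.mem_coe, Nat.mem_divisors]
    refine ⟨?_, hpos.ne'⟩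
    rw [h1]; simpa using h3
  · intro w hw w' hw' he
    obtain ⟨s, hs, h1, h2, h3⟩ := main w (hT w hw)
    obtain ⟨s', hs', h1', h2', h3'⟩ := main w' (hT w' hw')
    simp only [h1, h1', Nat.add_sub_cancel_left] at he
    subst he
    have ey : y w = y w' := by
      apply Nat.eq_of_mul_eq_mul_left (Nat.succ_pos A : 0 < A')
      exact h1.trans h1'.symm
    have ez : z w = z w' := by
      apply Nat.eq_of_mul_eq_mul_left hs
      rw [h2, h2', ey]
    exact h w w' (hT _ hw) (hT _ hw') ey ez

/-- Data attached to a solution. -/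
structure Wit where
  k1 : ℕ
  k2 : ℕ
  k3 : ℕ
  k4 : ℕ
  N1 : ℕ
  N2 : ℕ
  N3 : ℕ
  N4 : ℕ
  x12 : ℕ
  x13 : ℕ
  x14 : ℕ
  x23 : ℕ
  x24 : ℕ
  x34 : ℕ
  x123 : ℕ
  x124 : ℕ
  x134 : ℕ
  x234 : ℕ
  x1234 : ℕ

/-- the unit fraction denominator `a1` -/
def Wit.a1 (w : Wit) : ℕ := w.k1 * (w.x12 * w.x13 * w.x14 * w.x123 * w.x124 * w.x134 * w.x1234)

/-- the unit fraction denominator `a2` -/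
def Wit.a2 (w : Wit) : ℕ := w.k2 * (w.x12 * w.x23 * w.x24 * w.x123 * w.x124 * w.x234 * w.x1234)

/-- the unit fraction denominator `a3` -/
def Wit.a3 (w : Wit) : ℕ := w.k3 * (w.x13 * w.x23 * w.x34 * w.x123 * w.x134 * w.x234 * w.x1234)

/-- the unit fraction denominator `a4` -/
def Wit.a4 (w : Wit) : ℕ := w.k4 * (w.x14 * w.x24 * w.x34 * w.x124 * w.x134 * w.x234 * w.x1234)

/-- the common multiple -/
def Wit.L (w : Wit) : ℕ := w.x12 * w.x13 * w.x14 * w.x23 * w.x24 * w.x34 * w.x123 * w.x124 * w.x134 * w.x234 * w.x1234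

/-- validity of the data -/
structure OK (m n V : ℕ) (w : Wit) : Prop where
  hk1 : w.k1 * w.N1 = n
  hk2 : w.k2 * w.N2 = n
  hk3 : w.k3 * w.N3 = n
  hk4 : w.k4 * w.N4 = n
  pN1 : 0 < w.N1
  pN2 : 0 < w.N2
  pN3 : 0 < w.N3
  pN4 : 0 < w.N4
  px12 : 0 < w.x12
  px13 : 0 < w.x13
  px14 : 0 < w.x14
  px23 : 0 < w.x23
  px24 : 0 < w.x24
  px34 : 0 < w.x34
  px123 : 0 < w.x123
  px124 : 0 < w.x124
  px134 : 0 < w.x134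
  px234 : 0 < w.x234
  px1234 : 0 < w.x1234
  eq : m * w.L = w.N1 * (w.x23 * w.x24 * w.x34 * w.x234) + w.N2 * (w.x13 * w.x14 * w.x34 * w.x134) + w.N3 * (w.x12 * w.x14 * w.x24 * w.x124) + w.N4 * (w.x12 * w.x13 * w.x23 * w.x123)
  hV : m * w.L ≤ V
  hm : 0 < m
  hn : 0 < n
  hA : w.a1 * w.a2 ≤ V
  hnV : n ≤ V
  hlt : n / m < w.a1

lemma OK.ext {m n V : ℕ} {w w' : Wit} (h : OK m n V w) (h' : OK m n V w')
    (eN1 : w.N1 = w'.N1)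
    (eN2 : w.N2 = w'.N2)
    (eN3 : w.N3 = w'.N3)
    (eN4 : w.N4 = w'.N4)
    (ex12 : w.x12 = w'.x12)
    (ex13 : w.x13 = w'.x13)
    (ex14 : w.x14 = w'.x14)
    (ex23 : w.x23 = w'.x23)
    (ex24 : w.x24 = w'.x24)
    (ex34 : w.x34 = w'.x34)
    (ex123 : w.x123 = w'.x123)
    (ex124 : w.x124 = w'.x124)
    (ex134 : w.x134 = w'.x134)
    (ex234 : w.x234 = w'.x234)
    (ex1234 : w.x1234 = w'.x1234) : w = w' := by
  have f1 : w.k1 = w'.k1 := by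
    apply Nat.eq_of_mul_eq_mul_right h.pN1
    rw [h.hk1, eN1, h'.hk1]
  have f2 : w.k2 = w'.k2 := by
    apply Nat.eq_of_mul_eq_mul_right h.pN2
    rw [h.hk2, eN2, h'.hk2]
  have f3 : w.k3 = w'.k3 := by
    apply Nat.eq_of_mul_eq_mul_right h.pN3
    rw [h.hk3, eN3, h'.hk3]
  have f4 : w.k4 = w'.k4 := by
    apply Nat.eq_of_mul_eq_mul_right h.pN4
    rw [h.hk4, eN4, h'.hk4]
  cases w; cases w'
  simp only at *
  subst_vars
  rfl

/-- the shifted first denominator -/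
def Wit.kap (m n : ℕ) (w : Wit) : ℕ := w.a1 - n / m

/-- counting key -/
def Wit.K0 (w : Wit) : ℕ := w.x12 * w.x13 * w.x14 * w.x23 * w.x24 * w.x123 * w.x124 * w.x1234

/-- counting key -/
def Wit.K1 (m n : ℕ) (w : Wit) : ℕ := w.kap m n * w.x23 * w.x234

/-- counting key -/
def Wit.K2 (m n : ℕ) (w : Wit) : ℕ := w.kap m n * w.x24 * w.x234

/-- counting key -/
def Wit.K3 (w : Wit) : ℕ := w.a2 * w.x13 * w.x134

/-- counting key -/
def Wit.K4 (w : Wit) : ℕ := w.a2 * w.x14 * w.x134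

/-- counting key -/
def Wit.K5 (m n : ℕ) (w : Wit) : ℕ := w.kap m n * w.x23 * w.x24

lemma OK.kpos {m n V : ℕ} {w : Wit} (h : OK m n V w) : 0 < w.k1 ∧ 0 < w.k2 := by
  have pk1 : 0 < w.k1 := Nat.pos_of_ne_zero (fun h0 => by
    have h1 := h.hk1; have h2 := h.hn; rw [h0] at h1; omega)
  have pk2 : 0 < w.k2 := Nat.pos_of_ne_zero (fun h0 => by
    have h1 := h.hk2; have h2 := h.hn; rw [h0] at h1; omega)
  exact ⟨pk1, pk2⟩

lemma OK.a1pos {m n V : ℕ} {w : Wit} (h : OK m n V w) : 0 < w.a1 := by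
  have pN1 := h.pN1
  have pN2 := h.pN2
  have pN3 := h.pN3
  have pN4 := h.pN4
  have px12 := h.px12
  have px13 := h.px13
  have px14 := h.px14
  have px23 := h.px23
  have px24 := h.px24
  have px34 := h.px34
  have px123 := h.px123
  have px124 := h.px124
  have px134 := h.px134
  have px234 := h.px234
  have px1234 := h.px1234
  have := h.kpos.1
  unfold Wit.a1; positivity

lemma OK.a2pos {m n V : ℕ} {w : Wit} (h : OK m n V w) : 0 < w.a2 := by
  have pN1 := h.pN1
  have pN2 := h.pN2
  have pN3 := h.pN3
  have pN4 := h.pN4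
  have px12 := h.px12
  have px13 := h.px13
  have px14 := h.px14
  have px23 := h.px23
  have px24 := h.px24
  have px34 := h.px34
  have px123 := h.px123
  have px124 := h.px124
  have px134 := h.px134
  have px234 := h.px234
  have px1234 := h.px1234
  have := h.kpos.2
  unfold Wit.a2; positivity

lemma OK.kappos {m n V : ℕ} {w : Wit} (h : OK m n V w) : 0 < w.kap m n := by
  have := h.hlt
  unfold Wit.kap; omega

lemma Wit.kap_le (m n : ℕ) (w : Wit) : w.kap m n ≤ w.a1 := Nat.sub_le _ _

lemma OK.K0b {m n V : ℕ} {w : Wit} (h : OK m n V w) : 0 < w.K0 ∧ w.K0 ≤ V := by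
  have pN1 := h.pN1
  have pN2 := h.pN2
  have pN3 := h.pN3
  have pN4 := h.pN4
  have px12 := h.px12
  have px13 := h.px13
  have px14 := h.px14
  have px23 := h.px23
  have px24 := h.px24
  have px34 := h.px34
  have px123 := h.px123
  have px124 := h.px124
  have px134 := h.px134
  have px234 := h.px234
  have px1234 := h.px1234
  have q1 := h.a1pos
  have q2 := h.a2pos
  have q3 := h.kappos
  have q4 := h.kpos
  have q5 := h.hm
  refine ⟨by unfold Wit.K0; positivity, ?_⟩
  refine le_trans ?_ h.hV
  have e : m * w.L = w.K0 * (m * (w.x34 * w.x134 * w.x234)) := by unfold Wit.L Wit.K0; ring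
  rw [e]
  exact Nat.le_mul_of_pos_right _ (by positivity)

lemma OK.K1b {m n V : ℕ} {w : Wit} (h : OK m n V w) : 0 < w.K1 m n ∧ w.K1 m n ≤ V := by
  have pN1 := h.pN1
  have pN2 := h.pN2
  have pN3 := h.pN3
  have pN4 := h.pN4
  have px12 := h.px12
  have px13 := h.px13
  have px14 := h.px14
  have px23 := h.px23
  have px24 := h.px24
  have px34 := h.px34
  have px123 := h.px123
  have px124 := h.px124
  have px134 := h.px134
  have px234 := h.px234
  have px1234 := h.px1234
  have q1 := h.a1pos
  have q2 := h.a2pos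
  have q3 := h.kappos
  have q4 := h.kpos
  have q5 := h.hm
  refine ⟨by unfold Wit.K1; positivity, ?_⟩
  refine le_trans ?_ h.hA
  have e : w.a2 = w.x23 * w.x234 * (w.k2 * (w.x12 * w.x24 * w.x123 * w.x124 * w.x1234)) := by unfold Wit.a2; ring
  have e2 : w.x23 * w.x234 ≤ w.a2 := by
    rw [e]
    exact Nat.le_mul_of_pos_right _ (by have := q4.1; have := q4.2; positivity)
  calc w.K1 m n = w.kap m n * (w.x23 * w.x234) := by unfold Wit.K1; ring
    _ ≤ w.a1 * w.a2 := Nat.mul_le_mul (w.kap_le m n) e2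

lemma OK.K2b {m n V : ℕ} {w : Wit} (h : OK m n V w) : 0 < w.K2 m n ∧ w.K2 m n ≤ V := by
  have pN1 := h.pN1
  have pN2 := h.pN2
  have pN3 := h.pN3
  have pN4 := h.pN4
  have px12 := h.px12
  have px13 := h.px13
  have px14 := h.px14
  have px23 := h.px23
  have px24 := h.px24
  have px34 := h.px34
  have px123 := h.px123
  have px124 := h.px124
  have px134 := h.px134
  have px234 := h.px234
  have px1234 := h.px1234
  have q1 := h.a1pos
  have q2 := h.a2pos
  have q3 := h.kappos
  have q4 := h.kpos
  have q5 := h.hm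
  refine ⟨by unfold Wit.K2; positivity, ?_⟩
  refine le_trans ?_ h.hA
  have e : w.a2 = w.x24 * w.x234 * (w.k2 * (w.x12 * w.x23 * w.x123 * w.x124 * w.x1234)) := by unfold Wit.a2; ring
  have e2 : w.x24 * w.x234 ≤ w.a2 := by
    rw [e]
    exact Nat.le_mul_of_pos_right _ (by have := q4.1; have := q4.2; positivity)
  calc w.K2 m n = w.kap m n * (w.x24 * w.x234) := by unfold Wit.K2; ring
    _ ≤ w.a1 * w.a2 := Nat.mul_le_mul (w.kap_le m n) e2

lemma OK.K3b {m n V : ℕ} {w : Wit} (h : OK m n V w) : 0 < w.K3 ∧ w.K3 ≤ V := by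
  have pN1 := h.pN1
  have pN2 := h.pN2
  have pN3 := h.pN3
  have pN4 := h.pN4
  have px12 := h.px12
  have px13 := h.px13
  have px14 := h.px14
  have px23 := h.px23
  have px24 := h.px24
  have px34 := h.px34
  have px123 := h.px123
  have px124 := h.px124
  have px134 := h.px134
  have px234 := h.px234
  have px1234 := h.px1234
  have q1 := h.a1pos
  have q2 := h.a2pos
  have q3 := h.kappos
  have q4 := h.kpos
  have q5 := h.hm
  refine ⟨by unfold Wit.K3; positivity, ?_⟩
  refine le_trans ?_ h.hA
  have e : w.a1 = w.x13 * w.x134 * (w.k1 * (w.x12 * w.x14 * w.x123 * w.x124 * w.x1234)) := by unfold Wit.a1; ring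
  have e2 : w.x13 * w.x134 ≤ w.a1 := by
    rw [e]
    exact Nat.le_mul_of_pos_right _ (by have := q4.1; have := q4.2; positivity)
  calc w.K3 = (w.x13 * w.x134) * w.a2 := by unfold Wit.K3; ring
    _ ≤ w.a1 * w.a2 := Nat.mul_le_mul_right _ e2

lemma OK.K4b {m n V : ℕ} {w : Wit} (h : OK m n V w) : 0 < w.K4 ∧ w.K4 ≤ V := by
  have pN1 := h.pN1
  have pN2 := h.pN2
  have pN3 := h.pN3
  have pN4 := h.pN4
  have px12 := h.px12
  have px13 := h.px13
  have px14 := h.px14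
  have px23 := h.px23
  have px24 := h.px24
  have px34 := h.px34
  have px123 := h.px123
  have px124 := h.px124
  have px134 := h.px134
  have px234 := h.px234
  have px1234 := h.px1234
  have q1 := h.a1pos
  have q2 := h.a2pos
  have q3 := h.kappos
  have q4 := h.kpos
  have q5 := h.hm
  refine ⟨by unfold Wit.K4; positivity, ?_⟩
  refine le_trans ?_ h.hA
  have e : w.a1 = w.x14 * w.x134 * (w.k1 * (w.x12 * w.x13 * w.x123 * w.x124 * w.x1234)) := by unfold Wit.a1; ring
  have e2 : w.x14 * w.x134 ≤ w.a1 := by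
    rw [e]
    exact Nat.le_mul_of_pos_right _ (by have := q4.1; have := q4.2; positivity)
  calc w.K4 = (w.x14 * w.x134) * w.a2 := by unfold Wit.K4; ring
    _ ≤ w.a1 * w.a2 := Nat.mul_le_mul_right _ e2

lemma OK.K5b {m n V : ℕ} {w : Wit} (h : OK m n V w) : 0 < w.K5 m n ∧ w.K5 m n ≤ V := by
  have pN1 := h.pN1
  have pN2 := h.pN2
  have pN3 := h.pN3
  have pN4 := h.pN4
  have px12 := h.px12
  have px13 := h.px13
  have px14 := h.px14
  have px23 := h.px23
  have px24 := h.px24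
  have px34 := h.px34
  have px123 := h.px123
  have px124 := h.px124
  have px134 := h.px134
  have px234 := h.px234
  have px1234 := h.px1234
  have q1 := h.a1pos
  have q2 := h.a2pos
  have q3 := h.kappos
  have q4 := h.kpos
  have q5 := h.hm
  refine ⟨by unfold Wit.K5; positivity, ?_⟩
  refine le_trans ?_ h.hA
  have e : w.a2 = w.x23 * w.x24 * (w.k2 * (w.x12 * w.x123 * w.x124 * w.x234 * w.x1234)) := by unfold Wit.a2; ring
  have e2 : w.x23 * w.x24 ≤ w.a2 := by
    rw [e]
    exact Nat.le_mul_of_pos_right _ (by have := q4.1; have := q4.2; positivity)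
  calc w.K5 m n = w.kap m n * (w.x23 * w.x24) := by unfold Wit.K5; ring
    _ ≤ w.a1 * w.a2 := Nat.mul_le_mul (w.kap_le m n) e2

lemma count0 {m n V B D M : ℕ} (hD : ∀ k, k ≠ 0 → k ≤ M → k.divisors.card ≤ D)
    (hD1 : 1 ≤ D) (hM : 2 * V ^ 2 ≤ M) (hVM : V ≤ M) :
    CB (fun w => OK m n V w ∧ w.K0 ≤ B) (B * D ^ 16) := by
  have hbd : B * (D ^ 12 * (D ^ 1 * D)) ≤ B * D ^ 16 := by
    have : D ^ 12 * (D ^ 1 * D) = D ^ 14 := by ring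
    rw [this]
    exact Nat.mul_le_mul_left _ (Nat.pow_le_pow_right hD1 (by norm_num))
  refine (CB_key (fun w => w.K0) (fun w hw => ⟨hw.1.K0b.1, hw.2⟩) ?_).mono hbd
  intro w0 hw0
  refine CB_vec (r := 12) hD (fun w => ![w.N1, w.N2, w.N3, w.N4, w.x12, w.x13, w.x14, w.x23, w.x24, w.x123, w.x124, w.x1234])
    ![n, n, n, n, w0.K0, w0.K0, w0.K0, w0.K0, w0.K0, w0.K0, w0.K0, w0.K0] ?_ ?_ ?_
  · have g1 : n ≠ 0 ∧ n ≤ M := ⟨hw0.1.hn.ne', hw0.1.hnV.trans hVM⟩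
    have g2 : w0.K0 ≠ 0 ∧ w0.K0 ≤ M := ⟨hw0.1.K0b.1.ne', hw0.1.K0b.2.trans hVM⟩
    intro i
    fin_cases i <;> first | exact g1 | exact g2
  · intro w hw
    have hk : w.K0 = w0.K0 := hw.2
    have hO := hw.1.1
    have dN1 : w.N1 ∣ n := Dvd.intro_left _ hO.hk1
    have dN2 : w.N2 ∣ n := Dvd.intro_left _ hO.hk2
    have dN3 : w.N3 ∣ n := Dvd.intro_left _ hO.hk3
    have dN4 : w.N4 ∣ n := Dvd.intro_left _ hO.hk4
    obtain ⟨dx12, dx13, dx14, dx23, dx24, dx123, dx124, dx1234⟩ :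
        w.x12 ∣ w0.K0 ∧ w.x13 ∣ w0.K0 ∧ w.x14 ∣ w0.K0 ∧ w.x23 ∣ w0.K0 ∧ w.x24 ∣ w0.K0 ∧ w.x123 ∣ w0.K0 ∧ w.x124 ∣ w0.K0 ∧ w.x1234 ∣ w0.K0 := by
      rw [← hk]
      unfold Wit.K0
      refine ⟨?_, ?_, ?_, ?_, ?_, ?_, ?_, ?_⟩ <;>
        (repeat (first | exact dvd_rfl | exact dvd_mul_left _ _ | exact dvd_mul_right _ _ | apply Dvd.dvd.mul_right))
    intro i
    fin_cases i <;> assumption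
  intro w2 hw2
  have hO2 := hw2.1.1
  have hS : 0 < w2.N3 * (w2.x12 * w2.x14 * w2.x24 * w2.x124) + w2.N4 * (w2.x12 * w2.x13 * w2.x23 * w2.x123) := by
    have := hO2.pN3; have := hO2.px12; have := hO2.px14; have := hO2.px24; have := hO2.px124
    positivity
  have hSV : w2.N3 * (w2.x12 * w2.x14 * w2.x24 * w2.x124) + w2.N4 * (w2.x12 * w2.x13 * w2.x23 * w2.x123) ≤ M := by
    refine le_trans ?_ (hO2.hV.trans hVM)
    rw [hO2.eq]
    omega
  have hfix : ∀ w, (((OK m n V w ∧ w.K0 ≤ B) ∧ w.K0 = w0.K0) ∧ ![w.N1, w.N2, w.N3, w.N4, w.x12, w.x13, w.x14, w.x23, w.x24, w.x123, w.x124, w.x1234] =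
      ![w2.N1, w2.N2, w2.N3, w2.N4, w2.x12, w2.x13, w2.x14, w2.x23, w2.x24, w2.x123, w2.x124, w2.x1234]) → OK m n V w ∧ w.N1 = w2.N1 ∧ w.N2 = w2.N2 ∧ w.N3 = w2.N3 ∧ w.N4 = w2.N4 ∧ w.x12 = w2.x12 ∧ w.x13 = w2.x13 ∧ w.x14 = w2.x14 ∧ w.x23 = w2.x23 ∧ w.x24 = w2.x24 ∧ w.x123 = w2.x123 ∧ w.x124 = w2.x124 ∧ w.x1234 = w2.x1234 := by
    intro w hw
    refine ⟨hw.1.1.1, ?_⟩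
    have h := hw.2
    simpa only [Matrix.vecCons_inj, and_true] using h
  refine CB_vec (r := 1) hD (fun w => ![w.x34]) ![w2.N3 * (w2.x12 * w2.x14 * w2.x24 * w2.x124) + w2.N4 * (w2.x12 * w2.x13 * w2.x23 * w2.x123)] ?_ ?_ ?_
  · intro i
    fin_cases i
    exact ⟨hS.ne', hSV⟩
  · intro w hw i
    fin_cases i
    obtain ⟨h, eN1, eN2, eN3, eN4, ex12, ex13, ex14, ex23, ex24, ex123, ex124, ex1234⟩ := hfix w hw
    have he := h.eq
    simp only [Wit.L, eN1, eN2, eN3, eN4, ex12, ex13, ex14, ex23, ex24, ex123, ex124, ex1234] at he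
    simp only [Fin.zero_eta, Fin.isValue, Matrix.cons_val_fin_one]
    have e : w.x34 * (m * (w2.x12 * w2.x13 * w2.x14 * w2.x23 * w2.x24 * w2.x123 * w2.x124 * w2.x1234 * w.x134 * w.x234)) =
      w.x34 * (w2.N1 * (w2.x23 * w2.x24 * w.x234) + w2.N2 * (w2.x13 * w2.x14 * w.x134)) +
      (w2.N3 * (w2.x12 * w2.x14 * w2.x24 * w2.x124) + w2.N4 * (w2.x12 * w2.x13 * w2.x23 * w2.x123)) := by linarith
    exact (Nat.dvd_add_right (dvd_mul_right _ _)).1 (e ▸ dvd_mul_right _ _)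
  intro w3 hw3
  have hO3 := hw3.1.1.1
  have hfix2 : ∀ w, ((((OK m n V w ∧ w.K0 ≤ B) ∧ w.K0 = w0.K0) ∧ ![w.N1, w.N2, w.N3, w.N4, w.x12, w.x13, w.x14, w.x23, w.x24, w.x123, w.x124, w.x1234] =
      ![w2.N1, w2.N2, w2.N3, w2.N4, w2.x12, w2.x13, w2.x14, w2.x23, w2.x24, w2.x123, w2.x124, w2.x1234]) ∧ ![w.x34] = ![w3.x34]) →
      OK m n V w ∧ w.N1 = w3.N1 ∧ w.N2 = w3.N2 ∧ w.N3 = w3.N3 ∧ w.N4 = w3.N4 ∧ w.x12 = w3.x12 ∧ w.x13 = w3.x13 ∧ w.x14 = w3.x14 ∧ w.x23 = w3.x23 ∧ w.x24 = w3.x24 ∧ w.x123 = w3.x123 ∧ w.x124 = w3.x124 ∧ w.x1234 = w3.x1234 ∧ w.x34 = w3.x34 := by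
    intro w hw
    obtain ⟨h, eN1, eN2, eN3, eN4, ex12, ex13, ex14, ex23, ex24, ex123, ex124, ex1234⟩ := hfix w hw.1
    obtain ⟨h', fN1, fN2, fN3, fN4, fx12, fx13, fx14, fx23, fx24, fx123, fx124, fx1234⟩ := hfix w3 hw3
    refine ⟨h, eN1.trans fN1.symm, eN2.trans fN2.symm, eN3.trans fN3.symm, eN4.trans fN4.symm, ex12.trans fx12.symm, ex13.trans fx13.symm, ex14.trans fx14.symm, ex23.trans fx23.symm, ex24.trans fx24.symm, ex123.trans fx123.symm, ex124.trans fx124.symm, ex1234.trans fx1234.symm, ?_⟩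
    simpa using hw.2
  refine CB_bil hD hM (fun w => w.x134) (fun w => w.x234) (m * (w3.x12 * w3.x13 * w3.x14 * w3.x23 * w3.x24 * w3.x34 * w3.x123 * w3.x124 * w3.x1234)) 0
    (w3.N2 * (w3.x13 * w3.x14 * w3.x34)) (w3.N1 * (w3.x23 * w3.x24 * w3.x34)) (w3.N3 * (w3.x12 * w3.x14 * w3.x24 * w3.x124) + w3.N4 * (w3.x12 * w3.x13 * w3.x23 * w3.x123)) ?_ ?_ ?_
  · have := hO3.pN3; have := hO3.px12; have := hO3.px14; have := hO3.px24; have := hO3.px124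
    positivity
  · intro w hw
    obtain ⟨h, eN1, eN2, eN3, eN4, ex12, ex13, ex14, ex23, ex24, ex123, ex124, ex1234, ex34⟩ := hfix2 w hw
    have he := h.eq
    have hv := h.hV
    simp only [Wit.L, eN1, eN2, eN3, eN4, ex12, ex13, ex14, ex23, ex24, ex123, ex124, ex1234, ex34] at he hv
    refine ⟨h.px134, h.px234, by linarith, by linarith⟩
  · intro w w' hw hw' ey ez
    obtain ⟨h, eN1, eN2, eN3, eN4, ex12, ex13, ex14, ex23, ex24, ex123, ex124, ex1234, ex34⟩ := hfix2 w hw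
    obtain ⟨h', fN1, fN2, fN3, fN4, fx12, fx13, fx14, fx23, fx24, fx123, fx124, fx1234, fx34⟩ := hfix2 w' hw'
    exact h.ext h' (eN1.trans fN1.symm) (eN2.trans fN2.symm) (eN3.trans fN3.symm) (eN4.trans fN4.symm) (ex12.trans fx12.symm) (ex13.trans fx13.symm) (ex14.trans fx14.symm) (ex23.trans fx23.symm) (ex24.trans fx24.symm) (ex34.trans fx34.symm) (ex123.trans fx123.symm) (ex124.trans fx124.symm) ey ez (ex1234.trans fx1234.symm)

lemma count1 {m n V B D M : ℕ} (hD : ∀ k, k ≠ 0 → k ≤ M → k.divisors.card ≤ D)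
    (hD1 : 1 ≤ D) (hM : 2 * V ^ 2 ≤ M) (hVM : V ≤ M) :
    CB (fun w => OK m n V w ∧ w.K1 m n ≤ B) (B * D ^ 16) := by
  have hbd : B * (D ^ 1 * (D ^ 13 * D)) ≤ B * D ^ 16 := by
    have : D ^ 1 * (D ^ 13 * D) = D ^ 15 := by ring
    rw [this]
    exact Nat.mul_le_mul_left _ (Nat.pow_le_pow_right hD1 (by norm_num))
  refine (CB_key (fun w => w.K1 m n) (fun w hw => ⟨hw.1.K1b.1, hw.2⟩) ?_).mono hbd
  intro w0 hw0
  refine CB_vec (r := 1) hD (fun w => ![w.kap m n]) ![w0.K1 m n] ?_ ?_ ?_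
  · intro i
    fin_cases i
    exact ⟨hw0.1.K1b.1.ne', hw0.1.K1b.2.trans hVM⟩
  · rintro w ⟨hw, hk⟩ i
    fin_cases i
    have hk : w.K1 m n = w0.K1 m n := hk
    simp only [Fin.zero_eta, Fin.isValue, Matrix.cons_val_fin_one]
    rw [← hk]
    unfold Wit.K1
    repeat (first | exact dvd_rfl | exact dvd_mul_left _ _ | exact dvd_mul_right _ _ | apply Dvd.dvd.mul_right)
  intro w1 hw1
  have hA1 : w1.a1 ≤ M := by
    refine le_trans ?_ (hw1.1.1.hA.trans hVM)
    exact Nat.le_mul_of_pos_right _ hw1.1.1.a2pos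
  refine CB_vec (r := 13) hD (fun w => ![w.N1, w.N2, w.N3, w.N4, w.x12, w.x13, w.x14, w.x23, w.x123, w.x124, w.x134, w.x234, w.x1234])
    ![n, n, n, n, w1.a1, w1.a1, w1.a1, w0.K1 m n, w1.a1, w1.a1, w1.a1, w0.K1 m n, w1.a1] ?_ ?_ ?_
  · have g1 : n ≠ 0 ∧ n ≤ M := ⟨hw0.1.hn.ne', hw0.1.hnV.trans hVM⟩
    have g2 : w0.K1 m n ≠ 0 ∧ w0.K1 m n ≤ M := ⟨hw0.1.K1b.1.ne', hw0.1.K1b.2.trans hVM⟩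
    have g3 : w1.a1 ≠ 0 ∧ w1.a1 ≤ M := ⟨hw1.1.1.a1pos.ne', hA1⟩
    intro i
    fin_cases i <;> first | exact g1 | exact g2 | exact g3
  · intro w hw
    have hk : w.K1 m n = w0.K1 m n := hw.1.2
    have ha : w.a1 = w1.a1 := by
      have e1 : w.kap m n = w1.kap m n := by simpa using hw.2
      have e2 := hw.1.1.1.hlt
      have e3 := hw1.1.1.hlt
      unfold Wit.kap at e1
      omega
    have hO := hw.1.1.1
    have dN1 : w.N1 ∣ n := Dvd.intro_left _ hO.hk1
    have dN2 : w.N2 ∣ n := Dvd.intro_left _ hO.hk2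
    have dN3 : w.N3 ∣ n := Dvd.intro_left _ hO.hk3
    have dN4 : w.N4 ∣ n := Dvd.intro_left _ hO.hk4
    obtain ⟨dx12, dx13, dx14, dx123, dx124, dx134, dx1234⟩ :
        w.x12 ∣ w1.a1 ∧ w.x13 ∣ w1.a1 ∧ w.x14 ∣ w1.a1 ∧ w.x123 ∣ w1.a1 ∧ w.x124 ∣ w1.a1 ∧ w.x134 ∣ w1.a1 ∧ w.x1234 ∣ w1.a1 := by
      rw [← ha]
      unfold Wit.a1
      refine ⟨?_, ?_, ?_, ?_, ?_, ?_, ?_⟩ <;>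
        apply Dvd.dvd.mul_left <;>
        (repeat (first | exact dvd_rfl | exact dvd_mul_left _ _ | exact dvd_mul_right _ _ | apply Dvd.dvd.mul_right))
    obtain ⟨dx23, dx234⟩ :
        w.x23 ∣ w0.K1 m n ∧ w.x234 ∣ w0.K1 m n := by
      rw [← hk]
      unfold Wit.K1
      refine ⟨?_, ?_⟩ <;>
        (repeat (first | exact dvd_rfl | exact dvd_mul_left _ _ | exact dvd_mul_right _ _ | apply Dvd.dvd.mul_right))
    intro i
    fin_cases i <;> assumption
  intro w2 hw2
  have hO2 := hw2.1.1.1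
  have hfix : ∀ w, ((((OK m n V w ∧ w.K1 m n ≤ B) ∧ w.K1 m n = w0.K1 m n) ∧ ![w.kap m n] = ![w1.kap m n]) ∧ ![w.N1, w.N2, w.N3, w.N4, w.x12, w.x13, w.x14, w.x23, w.x123, w.x124, w.x134, w.x234, w.x1234] =
      ![w2.N1, w2.N2, w2.N3, w2.N4, w2.x12, w2.x13, w2.x14, w2.x23, w2.x123, w2.x124, w2.x134, w2.x234, w2.x1234]) → OK m n V w ∧ w.N1 = w2.N1 ∧ w.N2 = w2.N2 ∧ w.N3 = w2.N3 ∧ w.N4 = w2.N4 ∧ w.x12 = w2.x12 ∧ w.x13 = w2.x13 ∧ w.x14 = w2.x14 ∧ w.x23 = w2.x23 ∧ w.x123 = w2.x123 ∧ w.x124 = w2.x124 ∧ w.x134 = w2.x134 ∧ w.x234 = w2.x234 ∧ w.x1234 = w2.x1234 := by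
    intro w hw
    refine ⟨hw.1.1.1.1, ?_⟩
    have h := hw.2
    simpa only [Matrix.vecCons_inj, and_true] using h
  refine CB_bil hD hM (fun w => w.x24) (fun w => w.x34) (m * (w2.x12 * w2.x13 * w2.x14 * w2.x23 * w2.x123 * w2.x124 * w2.x134 * w2.x234 * w2.x1234)) (w2.N1 * (w2.x23 * w2.x234))
    (w2.N3 * (w2.x12 * w2.x14 * w2.x124)) (w2.N2 * (w2.x13 * w2.x14 * w2.x134)) (w2.N4 * (w2.x12 * w2.x13 * w2.x23 * w2.x123)) ?_ ?_ ?_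
  · have := hO2.pN4; have := hO2.px12; have := hO2.px13; have := hO2.px23; have := hO2.px123
    positivity
  · intro w hw
    obtain ⟨h, eN1, eN2, eN3, eN4, ex12, ex13, ex14, ex23, ex123, ex124, ex134, ex234, ex1234⟩ := hfix w hw
    have he := h.eq
    have hv := h.hV
    simp only [Wit.L, eN1, eN2, eN3, eN4, ex12, ex13, ex14, ex23, ex123, ex124, ex134, ex234, ex1234] at he hv
    refine ⟨h.px24, h.px34, by linarith, by linarith⟩
  · intro w w' hw hw' ey ez
    obtain ⟨h, eN1, eN2, eN3, eN4, ex12, ex13, ex14, ex23, ex123, ex124, ex134, ex234, ex1234⟩ := hfix w hw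
    obtain ⟨h', fN1, fN2, fN3, fN4, fx12, fx13, fx14, fx23, fx123, fx124, fx134, fx234, fx1234⟩ := hfix w' hw'
    exact h.ext h' (eN1.trans fN1.symm) (eN2.trans fN2.symm) (eN3.trans fN3.symm) (eN4.trans fN4.symm) (ex12.trans fx12.symm) (ex13.trans fx13.symm) (ex14.trans fx14.symm) (ex23.trans fx23.symm) ey ez (ex123.trans fx123.symm) (ex124.trans fx124.symm) (ex134.trans fx134.symm) (ex234.trans fx234.symm) (ex1234.trans fx1234.symm)

lemma count2 {m n V B D M : ℕ} (hD : ∀ k, k ≠ 0 → k ≤ M → k.divisors.card ≤ D)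
    (hD1 : 1 ≤ D) (hM : 2 * V ^ 2 ≤ M) (hVM : V ≤ M) :
    CB (fun w => OK m n V w ∧ w.K2 m n ≤ B) (B * D ^ 16) := by
  have hbd : B * (D ^ 1 * (D ^ 13 * D)) ≤ B * D ^ 16 := by
    have : D ^ 1 * (D ^ 13 * D) = D ^ 15 := by ring
    rw [this]
    exact Nat.mul_le_mul_left _ (Nat.pow_le_pow_right hD1 (by norm_num))
  refine (CB_key (fun w => w.K2 m n) (fun w hw => ⟨hw.1.K2b.1, hw.2⟩) ?_).mono hbd
  intro w0 hw0
  refine CB_vec (r := 1) hD (fun w => ![w.kap m n]) ![w0.K2 m n] ?_ ?_ ?_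
  · intro i
    fin_cases i
    exact ⟨hw0.1.K2b.1.ne', hw0.1.K2b.2.trans hVM⟩
  · rintro w ⟨hw, hk⟩ i
    fin_cases i
    have hk : w.K2 m n = w0.K2 m n := hk
    simp only [Fin.zero_eta, Fin.isValue, Matrix.cons_val_fin_one]
    rw [← hk]
    unfold Wit.K2
    repeat (first | exact dvd_rfl | exact dvd_mul_left _ _ | exact dvd_mul_right _ _ | apply Dvd.dvd.mul_right)
  intro w1 hw1
  have hA1 : w1.a1 ≤ M := by
    refine le_trans ?_ (hw1.1.1.hA.trans hVM)
    exact Nat.le_mul_of_pos_right _ hw1.1.1.a2pos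
  refine CB_vec (r := 13) hD (fun w => ![w.N1, w.N2, w.N3, w.N4, w.x12, w.x13, w.x14, w.x24, w.x123, w.x124, w.x134, w.x234, w.x1234])
    ![n, n, n, n, w1.a1, w1.a1, w1.a1, w0.K2 m n, w1.a1, w1.a1, w1.a1, w0.K2 m n, w1.a1] ?_ ?_ ?_
  · have g1 : n ≠ 0 ∧ n ≤ M := ⟨hw0.1.hn.ne', hw0.1.hnV.trans hVM⟩
    have g2 : w0.K2 m n ≠ 0 ∧ w0.K2 m n ≤ M := ⟨hw0.1.K2b.1.ne', hw0.1.K2b.2.trans hVM⟩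
    have g3 : w1.a1 ≠ 0 ∧ w1.a1 ≤ M := ⟨hw1.1.1.a1pos.ne', hA1⟩
    intro i
    fin_cases i <;> first | exact g1 | exact g2 | exact g3
  · intro w hw
    have hk : w.K2 m n = w0.K2 m n := hw.1.2
    have ha : w.a1 = w1.a1 := by
      have e1 : w.kap m n = w1.kap m n := by simpa using hw.2
      have e2 := hw.1.1.1.hlt
      have e3 := hw1.1.1.hlt
      unfold Wit.kap at e1
      omega
    have hO := hw.1.1.1
    have dN1 : w.N1 ∣ n := Dvd.intro_left _ hO.hk1
    have dN2 : w.N2 ∣ n := Dvd.intro_left _ hO.hk2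
    have dN3 : w.N3 ∣ n := Dvd.intro_left _ hO.hk3
    have dN4 : w.N4 ∣ n := Dvd.intro_left _ hO.hk4
    obtain ⟨dx12, dx13, dx14, dx123, dx124, dx134, dx1234⟩ :
        w.x12 ∣ w1.a1 ∧ w.x13 ∣ w1.a1 ∧ w.x14 ∣ w1.a1 ∧ w.x123 ∣ w1.a1 ∧ w.x124 ∣ w1.a1 ∧ w.x134 ∣ w1.a1 ∧ w.x1234 ∣ w1.a1 := by
      rw [← ha]
      unfold Wit.a1
      refine ⟨?_, ?_, ?_, ?_, ?_, ?_, ?_⟩ <;>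
        apply Dvd.dvd.mul_left <;>
        (repeat (first | exact dvd_rfl | exact dvd_mul_left _ _ | exact dvd_mul_right _ _ | apply Dvd.dvd.mul_right))
    obtain ⟨dx24, dx234⟩ :
        w.x24 ∣ w0.K2 m n ∧ w.x234 ∣ w0.K2 m n := by
      rw [← hk]
      unfold Wit.K2
      refine ⟨?_, ?_⟩ <;>
        (repeat (first | exact dvd_rfl | exact dvd_mul_left _ _ | exact dvd_mul_right _ _ | apply Dvd.dvd.mul_right))
    intro i
    fin_cases i <;> assumption
  intro w2 hw2
  have hO2 := hw2.1.1.1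
  have hfix : ∀ w, ((((OK m n V w ∧ w.K2 m n ≤ B) ∧ w.K2 m n = w0.K2 m n) ∧ ![w.kap m n] = ![w1.kap m n]) ∧ ![w.N1, w.N2, w.N3, w.N4, w.x12, w.x13, w.x14, w.x24, w.x123, w.x124, w.x134, w.x234, w.x1234] =
      ![w2.N1, w2.N2, w2.N3, w2.N4, w2.x12, w2.x13, w2.x14, w2.x24, w2.x123, w2.x124, w2.x134, w2.x234, w2.x1234]) → OK m n V w ∧ w.N1 = w2.N1 ∧ w.N2 = w2.N2 ∧ w.N3 = w2.N3 ∧ w.N4 = w2.N4 ∧ w.x12 = w2.x12 ∧ w.x13 = w2.x13 ∧ w.x14 = w2.x14 ∧ w.x24 = w2.x24 ∧ w.x123 = w2.x123 ∧ w.x124 = w2.x124 ∧ w.x134 = w2.x134 ∧ w.x234 = w2.x234 ∧ w.x1234 = w2.x1234 := by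
    intro w hw
    refine ⟨hw.1.1.1.1, ?_⟩
    have h := hw.2
    simpa only [Matrix.vecCons_inj, and_true] using h
  refine CB_bil hD hM (fun w => w.x23) (fun w => w.x34) (m * (w2.x12 * w2.x13 * w2.x14 * w2.x24 * w2.x123 * w2.x124 * w2.x134 * w2.x234 * w2.x1234)) (w2.N1 * (w2.x24 * w2.x234))
    (w2.N4 * (w2.x12 * w2.x13 * w2.x123)) (w2.N2 * (w2.x13 * w2.x14 * w2.x134)) (w2.N3 * (w2.x12 * w2.x14 * w2.x24 * w2.x124)) ?_ ?_ ?_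
  · have := hO2.pN3; have := hO2.px12; have := hO2.px14; have := hO2.px24; have := hO2.px124
    positivity
  · intro w hw
    obtain ⟨h, eN1, eN2, eN3, eN4, ex12, ex13, ex14, ex24, ex123, ex124, ex134, ex234, ex1234⟩ := hfix w hw
    have he := h.eq
    have hv := h.hV
    simp only [Wit.L, eN1, eN2, eN3, eN4, ex12, ex13, ex14, ex24, ex123, ex124, ex134, ex234, ex1234] at he hv
    refine ⟨h.px23, h.px34, by linarith, by linarith⟩
  · intro w w' hw hw' ey ez
    obtain ⟨h, eN1, eN2, eN3, eN4, ex12, ex13, ex14, ex24, ex123, ex124, ex134, ex234, ex1234⟩ := hfix w hw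
    obtain ⟨h', fN1, fN2, fN3, fN4, fx12, fx13, fx14, fx24, fx123, fx124, fx134, fx234, fx1234⟩ := hfix w' hw'
    exact h.ext h' (eN1.trans fN1.symm) (eN2.trans fN2.symm) (eN3.trans fN3.symm) (eN4.trans fN4.symm) (ex12.trans fx12.symm) (ex13.trans fx13.symm) (ex14.trans fx14.symm) ey (ex24.trans fx24.symm) ez (ex123.trans fx123.symm) (ex124.trans fx124.symm) (ex134.trans fx134.symm) (ex234.trans fx234.symm) (ex1234.trans fx1234.symm)

lemma count3 {m n V B D M : ℕ} (hD : ∀ k, k ≠ 0 → k ≤ M → k.divisors.card ≤ D)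
    (hD1 : 1 ≤ D) (hM : 2 * V ^ 2 ≤ M) (hVM : V ≤ M) :
    CB (fun w => OK m n V w ∧ w.K3 ≤ B) (B * D ^ 16) := by
  have hbd : B * (D ^ 13 * D) ≤ B * D ^ 16 := by
    have : D ^ 13 * D = D ^ 14 := by ring
    rw [this]
    exact Nat.mul_le_mul_left _ (Nat.pow_le_pow_right hD1 (by norm_num))
  refine (CB_key (fun w => w.K3) (fun w hw => ⟨hw.1.K3b.1, hw.2⟩) ?_).mono hbd
  intro w0 hw0
  refine CB_vec (r := 13) hD (fun w => ![w.N1, w.N2, w.N3, w.N4, w.x12, w.x13, w.x23, w.x24, w.x123, w.x124, w.x134, w.x234, w.x1234])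
    ![n, n, n, n, w0.K3, w0.K3, w0.K3, w0.K3, w0.K3, w0.K3, w0.K3, w0.K3, w0.K3] ?_ ?_ ?_
  · have g1 : n ≠ 0 ∧ n ≤ M := ⟨hw0.1.hn.ne', hw0.1.hnV.trans hVM⟩
    have g2 : w0.K3 ≠ 0 ∧ w0.K3 ≤ M := ⟨hw0.1.K3b.1.ne', hw0.1.K3b.2.trans hVM⟩
    intro i
    fin_cases i <;> first | exact g1 | exact g2
  · intro w hw
    have hk : w.K3 = w0.K3 := hw.2
    have hO := hw.1.1
    have dN1 : w.N1 ∣ n := Dvd.intro_left _ hO.hk1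
    have dN2 : w.N2 ∣ n := Dvd.intro_left _ hO.hk2
    have dN3 : w.N3 ∣ n := Dvd.intro_left _ hO.hk3
    have dN4 : w.N4 ∣ n := Dvd.intro_left _ hO.hk4
    obtain ⟨dx12, dx23, dx24, dx123, dx124, dx234, dx1234⟩ :
        w.x12 ∣ w0.K3 ∧ w.x23 ∣ w0.K3 ∧ w.x24 ∣ w0.K3 ∧ w.x123 ∣ w0.K3 ∧ w.x124 ∣ w0.K3 ∧ w.x234 ∣ w0.K3 ∧ w.x1234 ∣ w0.K3 := by
      rw [← hk]
      unfold Wit.K3 Wit.a2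
      refine ⟨?_, ?_, ?_, ?_, ?_, ?_, ?_⟩ <;>
        apply Dvd.dvd.mul_right <;>
        apply Dvd.dvd.mul_right <;>
        apply Dvd.dvd.mul_left <;>
        (repeat (first | exact dvd_rfl | exact dvd_mul_left _ _ | exact dvd_mul_right _ _ | apply Dvd.dvd.mul_right))
    obtain ⟨dx13, dx134⟩ :
        w.x13 ∣ w0.K3 ∧ w.x134 ∣ w0.K3 := by
      rw [← hk]
      unfold Wit.K3
      refine ⟨?_, ?_⟩ <;>
        (repeat (first | exact dvd_rfl | exact dvd_mul_left _ _ | exact dvd_mul_right _ _ | apply Dvd.dvd.mul_right))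
    intro i
    fin_cases i <;> assumption
  intro w2 hw2
  have hO2 := hw2.1.1
  have hfix : ∀ w, (((OK m n V w ∧ w.K3 ≤ B) ∧ w.K3 = w0.K3) ∧ ![w.N1, w.N2, w.N3, w.N4, w.x12, w.x13, w.x23, w.x24, w.x123, w.x124, w.x134, w.x234, w.x1234] =
      ![w2.N1, w2.N2, w2.N3, w2.N4, w2.x12, w2.x13, w2.x23, w2.x24, w2.x123, w2.x124, w2.x134, w2.x234, w2.x1234]) → OK m n V w ∧ w.N1 = w2.N1 ∧ w.N2 = w2.N2 ∧ w.N3 = w2.N3 ∧ w.N4 = w2.N4 ∧ w.x12 = w2.x12 ∧ w.x13 = w2.x13 ∧ w.x23 = w2.x23 ∧ w.x24 = w2.x24 ∧ w.x123 = w2.x123 ∧ w.x124 = w2.x124 ∧ w.x134 = w2.x134 ∧ w.x234 = w2.x234 ∧ w.x1234 = w2.x1234 := by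
    intro w hw
    refine ⟨hw.1.1.1, ?_⟩
    have h := hw.2
    simpa only [Matrix.vecCons_inj, and_true] using h
  refine CB_bil hD hM (fun w => w.x14) (fun w => w.x34) (m * (w2.x12 * w2.x13 * w2.x23 * w2.x24 * w2.x123 * w2.x124 * w2.x134 * w2.x234 * w2.x1234)) (w2.N2 * (w2.x13 * w2.x134))
    (w2.N3 * (w2.x12 * w2.x24 * w2.x124)) (w2.N1 * (w2.x23 * w2.x24 * w2.x234)) (w2.N4 * (w2.x12 * w2.x13 * w2.x23 * w2.x123)) ?_ ?_ ?_
  · have := hO2.pN4; have := hO2.px12; have := hO2.px13; have := hO2.px23; have := hO2.px123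
    positivity
  · intro w hw
    obtain ⟨h, eN1, eN2, eN3, eN4, ex12, ex13, ex23, ex24, ex123, ex124, ex134, ex234, ex1234⟩ := hfix w hw
    have he := h.eq
    have hv := h.hV
    simp only [Wit.L, eN1, eN2, eN3, eN4, ex12, ex13, ex23, ex24, ex123, ex124, ex134, ex234, ex1234] at he hv
    refine ⟨h.px14, h.px34, by linarith, by linarith⟩
  · intro w w' hw hw' ey ez
    obtain ⟨h, eN1, eN2, eN3, eN4, ex12, ex13, ex23, ex24, ex123, ex124, ex134, ex234, ex1234⟩ := hfix w hw
    obtain ⟨h', fN1, fN2, fN3, fN4, fx12, fx13, fx23, fx24, fx123, fx124, fx134, fx234, fx1234⟩ := hfix w' hw'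
    exact h.ext h' (eN1.trans fN1.symm) (eN2.trans fN2.symm) (eN3.trans fN3.symm) (eN4.trans fN4.symm) (ex12.trans fx12.symm) (ex13.trans fx13.symm) ey (ex23.trans fx23.symm) (ex24.trans fx24.symm) ez (ex123.trans fx123.symm) (ex124.trans fx124.symm) (ex134.trans fx134.symm) (ex234.trans fx234.symm) (ex1234.trans fx1234.symm)

lemma count4 {m n V B D M : ℕ} (hD : ∀ k, k ≠ 0 → k ≤ M → k.divisors.card ≤ D)
    (hD1 : 1 ≤ D) (hM : 2 * V ^ 2 ≤ M) (hVM : V ≤ M) :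
    CB (fun w => OK m n V w ∧ w.K4 ≤ B) (B * D ^ 16) := by
  have hbd : B * (D ^ 13 * D) ≤ B * D ^ 16 := by
    have : D ^ 13 * D = D ^ 14 := by ring
    rw [this]
    exact Nat.mul_le_mul_left _ (Nat.pow_le_pow_right hD1 (by norm_num))
  refine (CB_key (fun w => w.K4) (fun w hw => ⟨hw.1.K4b.1, hw.2⟩) ?_).mono hbd
  intro w0 hw0
  refine CB_vec (r := 13) hD (fun w => ![w.N1, w.N2, w.N3, w.N4, w.x12, w.x14, w.x23, w.x24, w.x123, w.x124, w.x134, w.x234, w.x1234])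
    ![n, n, n, n, w0.K4, w0.K4, w0.K4, w0.K4, w0.K4, w0.K4, w0.K4, w0.K4, w0.K4] ?_ ?_ ?_
  · have g1 : n ≠ 0 ∧ n ≤ M := ⟨hw0.1.hn.ne', hw0.1.hnV.trans hVM⟩
    have g2 : w0.K4 ≠ 0 ∧ w0.K4 ≤ M := ⟨hw0.1.K4b.1.ne', hw0.1.K4b.2.trans hVM⟩
    intro i
    fin_cases i <;> first | exact g1 | exact g2
  · intro w hw
    have hk : w.K4 = w0.K4 := hw.2
    have hO := hw.1.1
    have dN1 : w.N1 ∣ n := Dvd.intro_left _ hO.hk1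
    have dN2 : w.N2 ∣ n := Dvd.intro_left _ hO.hk2
    have dN3 : w.N3 ∣ n := Dvd.intro_left _ hO.hk3
    have dN4 : w.N4 ∣ n := Dvd.intro_left _ hO.hk4
    obtain ⟨dx12, dx23, dx24, dx123, dx124, dx234, dx1234⟩ :
        w.x12 ∣ w0.K4 ∧ w.x23 ∣ w0.K4 ∧ w.x24 ∣ w0.K4 ∧ w.x123 ∣ w0.K4 ∧ w.x124 ∣ w0.K4 ∧ w.x234 ∣ w0.K4 ∧ w.x1234 ∣ w0.K4 := by
      rw [← hk]
      unfold Wit.K4 Wit.a2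
      refine ⟨?_, ?_, ?_, ?_, ?_, ?_, ?_⟩ <;>
        apply Dvd.dvd.mul_right <;>
        apply Dvd.dvd.mul_right <;>
        apply Dvd.dvd.mul_left <;>
        (repeat (first | exact dvd_rfl | exact dvd_mul_left _ _ | exact dvd_mul_right _ _ | apply Dvd.dvd.mul_right))
    obtain ⟨dx14, dx134⟩ :
        w.x14 ∣ w0.K4 ∧ w.x134 ∣ w0.K4 := by
      rw [← hk]
      unfold Wit.K4
      refine ⟨?_, ?_⟩ <;>
        (repeat (first | exact dvd_rfl | exact dvd_mul_left _ _ | exact dvd_mul_right _ _ | apply Dvd.dvd.mul_right))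
    intro i
    fin_cases i <;> assumption
  intro w2 hw2
  have hO2 := hw2.1.1
  have hfix : ∀ w, (((OK m n V w ∧ w.K4 ≤ B) ∧ w.K4 = w0.K4) ∧ ![w.N1, w.N2, w.N3, w.N4, w.x12, w.x14, w.x23, w.x24, w.x123, w.x124, w.x134, w.x234, w.x1234] =
      ![w2.N1, w2.N2, w2.N3, w2.N4, w2.x12, w2.x14, w2.x23, w2.x24, w2.x123, w2.x124, w2.x134, w2.x234, w2.x1234]) → OK m n V w ∧ w.N1 = w2.N1 ∧ w.N2 = w2.N2 ∧ w.N3 = w2.N3 ∧ w.N4 = w2.N4 ∧ w.x12 = w2.x12 ∧ w.x14 = w2.x14 ∧ w.x23 = w2.x23 ∧ w.x24 = w2.x24 ∧ w.x123 = w2.x123 ∧ w.x124 = w2.x124 ∧ w.x134 = w2.x134 ∧ w.x234 = w2.x234 ∧ w.x1234 = w2.x1234 := by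
    intro w hw
    refine ⟨hw.1.1.1, ?_⟩
    have h := hw.2
    simpa only [Matrix.vecCons_inj, and_true] using h
  refine CB_bil hD hM (fun w => w.x13) (fun w => w.x34) (m * (w2.x12 * w2.x14 * w2.x23 * w2.x24 * w2.x123 * w2.x124 * w2.x134 * w2.x234 * w2.x1234)) (w2.N2 * (w2.x14 * w2.x134))
    (w2.N4 * (w2.x12 * w2.x23 * w2.x123)) (w2.N1 * (w2.x23 * w2.x24 * w2.x234)) (w2.N3 * (w2.x12 * w2.x14 * w2.x24 * w2.x124)) ?_ ?_ ?_
  · have := hO2.pN3; have := hO2.px12; have := hO2.px14; have := hO2.px24; have := hO2.px124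
    positivity
  · intro w hw
    obtain ⟨h, eN1, eN2, eN3, eN4, ex12, ex14, ex23, ex24, ex123, ex124, ex134, ex234, ex1234⟩ := hfix w hw
    have he := h.eq
    have hv := h.hV
    simp only [Wit.L, eN1, eN2, eN3, eN4, ex12, ex14, ex23, ex24, ex123, ex124, ex134, ex234, ex1234] at he hv
    refine ⟨h.px13, h.px34, by linarith, by linarith⟩
  · intro w w' hw hw' ey ez
    obtain ⟨h, eN1, eN2, eN3, eN4, ex12, ex14, ex23, ex24, ex123, ex124, ex134, ex234, ex1234⟩ := hfix w hw
    obtain ⟨h', fN1, fN2, fN3, fN4, fx12, fx14, fx23, fx24, fx123, fx124, fx134, fx234, fx1234⟩ := hfix w' hw'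
    exact h.ext h' (eN1.trans fN1.symm) (eN2.trans fN2.symm) (eN3.trans fN3.symm) (eN4.trans fN4.symm) (ex12.trans fx12.symm) ey (ex14.trans fx14.symm) (ex23.trans fx23.symm) (ex24.trans fx24.symm) ez (ex123.trans fx123.symm) (ex124.trans fx124.symm) (ex134.trans fx134.symm) (ex234.trans fx234.symm) (ex1234.trans fx1234.symm)

lemma count5 {m n V B D M : ℕ} (hD : ∀ k, k ≠ 0 → k ≤ M → k.divisors.card ≤ D)
    (hD1 : 1 ≤ D) (hM : 2 * V ^ 2 ≤ M) (hVM : V ≤ M) :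
    CB (fun w => OK m n V w ∧ w.K5 m n ≤ B) (B * D ^ 16) := by
  have hbd : B * (D ^ 1 * (D ^ 13 * D)) ≤ B * D ^ 16 := by
    have : D ^ 1 * (D ^ 13 * D) = D ^ 15 := by ring
    rw [this]
    exact Nat.mul_le_mul_left _ (Nat.pow_le_pow_right hD1 (by norm_num))
  refine (CB_key (fun w => w.K5 m n) (fun w hw => ⟨hw.1.K5b.1, hw.2⟩) ?_).mono hbd
  intro w0 hw0
  refine CB_vec (r := 1) hD (fun w => ![w.kap m n]) ![w0.K5 m n] ?_ ?_ ?_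
  · intro i
    fin_cases i
    exact ⟨hw0.1.K5b.1.ne', hw0.1.K5b.2.trans hVM⟩
  · rintro w ⟨hw, hk⟩ i
    fin_cases i
    have hk : w.K5 m n = w0.K5 m n := hk
    simp only [Fin.zero_eta, Fin.isValue, Matrix.cons_val_fin_one]
    rw [← hk]
    unfold Wit.K5
    repeat (first | exact dvd_rfl | exact dvd_mul_left _ _ | exact dvd_mul_right _ _ | apply Dvd.dvd.mul_right)
  intro w1 hw1
  have hA1 : w1.a1 ≤ M := by
    refine le_trans ?_ (hw1.1.1.hA.trans hVM)
    exact Nat.le_mul_of_pos_right _ hw1.1.1.a2pos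
  refine CB_vec (r := 13) hD (fun w => ![w.N1, w.N2, w.N3, w.N4, w.x12, w.x13, w.x14, w.x23, w.x24, w.x123, w.x124, w.x134, w.x1234])
    ![n, n, n, n, w1.a1, w1.a1, w1.a1, w0.K5 m n, w0.K5 m n, w1.a1, w1.a1, w1.a1, w1.a1] ?_ ?_ ?_
  · have g1 : n ≠ 0 ∧ n ≤ M := ⟨hw0.1.hn.ne', hw0.1.hnV.trans hVM⟩
    have g2 : w0.K5 m n ≠ 0 ∧ w0.K5 m n ≤ M := ⟨hw0.1.K5b.1.ne', hw0.1.K5b.2.trans hVM⟩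
    have g3 : w1.a1 ≠ 0 ∧ w1.a1 ≤ M := ⟨hw1.1.1.a1pos.ne', hA1⟩
    intro i
    fin_cases i <;> first | exact g1 | exact g2 | exact g3
  · intro w hw
    have hk : w.K5 m n = w0.K5 m n := hw.1.2
    have ha : w.a1 = w1.a1 := by
      have e1 : w.kap m n = w1.kap m n := by simpa using hw.2
      have e2 := hw.1.1.1.hlt
      have e3 := hw1.1.1.hlt
      unfold Wit.kap at e1
      omega
    have hO := hw.1.1.1
    have dN1 : w.N1 ∣ n := Dvd.intro_left _ hO.hk1
    have dN2 : w.N2 ∣ n := Dvd.intro_left _ hO.hk2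
    have dN3 : w.N3 ∣ n := Dvd.intro_left _ hO.hk3
    have dN4 : w.N4 ∣ n := Dvd.intro_left _ hO.hk4
    obtain ⟨dx12, dx13, dx14, dx123, dx124, dx134, dx1234⟩ :
        w.x12 ∣ w1.a1 ∧ w.x13 ∣ w1.a1 ∧ w.x14 ∣ w1.a1 ∧ w.x123 ∣ w1.a1 ∧ w.x124 ∣ w1.a1 ∧ w.x134 ∣ w1.a1 ∧ w.x1234 ∣ w1.a1 := by
      rw [← ha]
      unfold Wit.a1
      refine ⟨?_, ?_, ?_, ?_, ?_, ?_, ?_⟩ <;>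
        apply Dvd.dvd.mul_left <;>
        (repeat (first | exact dvd_rfl | exact dvd_mul_left _ _ | exact dvd_mul_right _ _ | apply Dvd.dvd.mul_right))
    obtain ⟨dx23, dx24⟩ :
        w.x23 ∣ w0.K5 m n ∧ w.x24 ∣ w0.K5 m n := by
      rw [← hk]
      unfold Wit.K5
      refine ⟨?_, ?_⟩ <;>
        (repeat (first | exact dvd_rfl | exact dvd_mul_left _ _ | exact dvd_mul_right _ _ | apply Dvd.dvd.mul_right))
    intro i
    fin_cases i <;> assumption
  intro w2 hw2
  have hO2 := hw2.1.1.1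
  have hfix : ∀ w, ((((OK m n V w ∧ w.K5 m n ≤ B) ∧ w.K5 m n = w0.K5 m n) ∧ ![w.kap m n] = ![w1.kap m n]) ∧ ![w.N1, w.N2, w.N3, w.N4, w.x12, w.x13, w.x14, w.x23, w.x24, w.x123, w.x124, w.x134, w.x1234] =
      ![w2.N1, w2.N2, w2.N3, w2.N4, w2.x12, w2.x13, w2.x14, w2.x23, w2.x24, w2.x123, w2.x124, w2.x134, w2.x1234]) → OK m n V w ∧ w.N1 = w2.N1 ∧ w.N2 = w2.N2 ∧ w.N3 = w2.N3 ∧ w.N4 = w2.N4 ∧ w.x12 = w2.x12 ∧ w.x13 = w2.x13 ∧ w.x14 = w2.x14 ∧ w.x23 = w2.x23 ∧ w.x24 = w2.x24 ∧ w.x123 = w2.x123 ∧ w.x124 = w2.x124 ∧ w.x134 = w2.x134 ∧ w.x1234 = w2.x1234 := by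
    intro w hw
    refine ⟨hw.1.1.1.1, ?_⟩
    have h := hw.2
    simpa only [Matrix.vecCons_inj, and_true] using h
  refine CB_bil hD hM (fun w => w.x34) (fun w => w.x234) (m * (w2.x12 * w2.x13 * w2.x14 * w2.x23 * w2.x24 * w2.x123 * w2.x124 * w2.x134 * w2.x1234)) (w2.N1 * (w2.x23 * w2.x24))
    (w2.N2 * (w2.x13 * w2.x14 * w2.x134)) 0 (w2.N3 * (w2.x12 * w2.x14 * w2.x24 * w2.x124) + w2.N4 * (w2.x12 * w2.x13 * w2.x23 * w2.x123)) ?_ ?_ ?_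
  · have := hO2.pN3; have := hO2.px12; have := hO2.px14; have := hO2.px24; have := hO2.px124
    positivity
  · intro w hw
    obtain ⟨h, eN1, eN2, eN3, eN4, ex12, ex13, ex14, ex23, ex24, ex123, ex124, ex134, ex1234⟩ := hfix w hw
    have he := h.eq
    have hv := h.hV
    simp only [Wit.L, eN1, eN2, eN3, eN4, ex12, ex13, ex14, ex23, ex24, ex123, ex124, ex134, ex1234] at he hv
    refine ⟨h.px34, h.px234, by linarith, by linarith⟩
  · intro w w' hw hw' ey ez
    obtain ⟨h, eN1, eN2, eN3, eN4, ex12, ex13, ex14, ex23, ex24, ex123, ex124, ex134, ex1234⟩ := hfix w hw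
    obtain ⟨h', fN1, fN2, fN3, fN4, fx12, fx13, fx14, fx23, fx24, fx123, fx124, fx134, fx1234⟩ := hfix w' hw'
    exact h.ext h' (eN1.trans fN1.symm) (eN2.trans fN2.symm) (eN3.trans fN3.symm) (eN4.trans fN4.symm) (ex12.trans fx12.symm) (ex13.trans fx13.symm) (ex14.trans fx14.symm) (ex23.trans fx23.symm) (ex24.trans fx24.symm) ey (ex123.trans fx123.symm) (ex124.trans fx124.symm) (ex134.trans fx134.symm) ez (ex1234.trans fx1234.symm)

lemma dvd_lcm_of_eq (m t1 t2 t3 t4 N1 N2 N3 N4 : ℕ) (h2 : 0 < t2) (h3 : 0 < t3) (h4 : 0 < t4)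
    (hc : Nat.Coprime t1 N1)
    (h : m * (t1 * t2 * t3 * t4) = N1 * (t2 * t3 * t4) + N2 * (t1 * t3 * t4) +
      N3 * (t1 * t2 * t4) + N4 * (t1 * t2 * t3)) : t1 ∣ Nat.lcm t2 (Nat.lcm t3 t4) := by
  set T := Nat.lcm t2 (Nat.lcm t3 t4) with hT
  obtain ⟨s2, e2⟩ : t2 ∣ T := Nat.dvd_lcm_left _ _
  obtain ⟨s3, e3⟩ : t3 ∣ T := (Nat.dvd_lcm_left _ _).trans (Nat.dvd_lcm_right _ _)
  obtain ⟨s4, e4⟩ : t4 ∣ T := (Nat.dvd_lcm_right _ _).trans (Nat.dvd_lcm_right _ _)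
  have key : t1 * (m * T) = t1 * (N2 * s2 + N3 * s3 + N4 * s4) + N1 * T := by
    apply Nat.eq_of_mul_eq_mul_right (show 0 < t2 * t3 * t4 by positivity)
    calc t1 * (m * T) * (t2 * t3 * t4) = T * (m * (t1 * t2 * t3 * t4)) := by ring
      _ = N1 * T * (t2 * t3 * t4) + N2 * t1 * t3 * t4 * T + N3 * t1 * t2 * t4 * T +
          N4 * t1 * t2 * t3 * T := by rw [h]; ring
      _ = N1 * T * (t2 * t3 * t4) + N2 * t1 * t3 * t4 * (t2 * s2) +
          N3 * t1 * t2 * t4 * (t3 * s3) + N4 * t1 * t2 * t3 * (t4 * s4) := by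
          rw [← e2, ← e3, ← e4]
      _ = _ := by ring
  have : t1 ∣ N1 * T := (Nat.dvd_add_right (dvd_mul_right _ _)).1 (key ▸ dvd_mul_right _ _)
  exact hc.dvd_of_dvd_mul_left this

/-- every solution carries data -/
lemma exists_wit (m n V a1 a2 a3 a4 : ℕ) (hm : 0 < m) (hn : 0 < n) (p1 : 0 < a1) (p2 : 0 < a2)
    (p3 : 0 < a3) (p4 : 0 < a4)
    (h : m * (a1 * a2 * a3 * a4) = n * (a2 * a3 * a4 + a1 * a3 * a4 + a1 * a2 * a4 + a1 * a2 * a3))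
    (hV : m * (a1 * a2 * a3 * a4) ≤ V) (hlt : n < m * a1) :
    ∃ w : Wit, OK m n V w ∧ w.a1 = a1 ∧ w.a2 = a2 ∧ w.a3 = a3 ∧ w.a4 = a4 := by
  have key : ∀ a : ℕ, 0 < a → ∃ k N t : ℕ, 0 < k ∧ 0 < N ∧ 0 < t ∧ k * N = n ∧ k * t = a ∧
      Nat.Coprime t N := by
    intro a ha
    have hk : 0 < Nat.gcd a n := Nat.gcd_pos_of_pos_left _ ha
    refine ⟨Nat.gcd a n, n / Nat.gcd a n, a / Nat.gcd a n, hk,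
      Nat.div_pos (Nat.gcd_le_right _ hn) hk, Nat.div_pos (Nat.gcd_le_left _ ha) hk,
      Nat.mul_div_cancel' (Nat.gcd_dvd_right _ _), Nat.mul_div_cancel' (Nat.gcd_dvd_left _ _),
      Nat.coprime_div_gcd_div_gcd hk⟩
  obtain ⟨k1, N1, t1, q1, r1, s1, u1, v1, c1⟩ := key a1 p1
  obtain ⟨k2, N2, t2, q2, r2, s2, u2, v2, c2⟩ := key a2 p2
  obtain ⟨k3, N3, t3, q3, r3, s3, u3, v3, c3⟩ := key a3 p3
  obtain ⟨k4, N4, t4, q4, r4, s4, u4, v4, c4⟩ := key a4 p4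
  have ht : m * (t1 * t2 * t3 * t4) = N1 * (t2 * t3 * t4) + N2 * (t1 * t3 * t4) +
      N3 * (t1 * t2 * t4) + N4 * (t1 * t2 * t3) := by
    apply Nat.eq_of_mul_eq_mul_left (show 0 < k1 * k2 * k3 * k4 by positivity)
    calc k1 * k2 * k3 * k4 * (m * (t1 * t2 * t3 * t4))
        = m * ((k1 * t1) * (k2 * t2) * (k3 * t3) * (k4 * t4)) := by ring
      _ = n * (a2 * a3 * a4) + n * (a1 * a3 * a4) + n * (a1 * a2 * a4) + n * (a1 * a2 * a3) := by
          rw [v1, v2, v3, v4, h]; ring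
      _ = (k1 * N1) * (k2 * t2 * (k3 * t3) * (k4 * t4)) +
          (k2 * N2) * (k1 * t1 * (k3 * t3) * (k4 * t4)) +
          (k3 * N3) * (k1 * t1 * (k2 * t2) * (k4 * t4)) +
          (k4 * N4) * (k1 * t1 * (k2 * t2) * (k3 * t3)) := by
          rw [u1, u2, u3, u4, v1, v2, v3, v4]
      _ = _ := by ring
  have d1 := dvd_lcm_of_eq m t1 t2 t3 t4 N1 N2 N3 N4 s2 s3 s4 c1 ht
  have d2 := dvd_lcm_of_eq m t2 t1 t3 t4 N2 N1 N3 N4 s1 s3 s4 c2 (by linarith)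
  have d3 := dvd_lcm_of_eq m t3 t1 t2 t4 N3 N1 N2 N4 s1 s2 s4 c3 (by linarith)
  have d4 := dvd_lcm_of_eq m t4 t1 t2 t3 N4 N1 N2 N3 s1 s2 s3 c4 (by linarith)
  obtain ⟨x12, x13, x14, x23, x24, x34, x123, x124, x134, x234, x1234, e1, e2, e3, e4⟩ :=
    rel_gcd t1 t2 t3 t4 s1.ne' s2.ne' s3.ne' s4.ne' d1 d2 d3 d4
  have P1 := s1
  have P2 := s2
  have P3 := s3
  rw [e1] at P1
  rw [e2] at P2
  rw [e3] at P3
  simp only [Nat.pos_iff_ne_zero, mul_ne_zero_iff] at P1 P2 P3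
  obtain ⟨⟨⟨⟨⟨⟨z12, z13⟩, z14⟩, z123⟩, z124⟩, z134⟩, z1234⟩ := P1
  obtain ⟨⟨⟨⟨⟨⟨-, z23⟩, z24⟩, -⟩, -⟩, z234⟩, -⟩ := P2
  obtain ⟨⟨⟨⟨⟨⟨-, -⟩, z34⟩, -⟩, -⟩, -⟩, -⟩ := P3
  have tR : t1 * t2 * t3 * t4 = (x12 * x13 * x14 * x23 * x24 * x34 * x123 * x124 * x134 * x234 *
      x1234) * (x12 * x13 * x14 * x23 * x24 * x34 * (x123 * x124 * x134 * x234) ^ 2 *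
      x1234 ^ 3) := by
    rw [e1, e2, e3, e4]; ring
  have hRpos : 0 < x12 * x13 * x14 * x23 * x24 * x34 * (x123 * x124 * x134 * x234) ^ 2 *
      x1234 ^ 3 := by positivity
  refine ⟨⟨k1, k2, k3, k4, N1, N2, N3, N4, x12, x13, x14, x23, x24, x34, x123, x124, x134, x234,
    x1234⟩, ?_, ?_, ?_, ?_, ?_⟩
  · refine ⟨u1, u2, u3, u4, r1, r2, r3, r4, by positivity, by positivity, by positivity,
      by positivity, by positivity, by positivity, by positivity, by positivity, by positivity,
      by positivity, by positivity, ?_, ?_, hm, hn, ?_, ?_, ?_⟩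
    · apply Nat.eq_of_mul_eq_mul_right hRpos
      simp only [Wit.L]
      rw [mul_assoc m, ← tR, ht, e1, e2, e3, e4]
      ring
    · refine le_trans ?_ hV
      simp only [Wit.L]
      calc _ ≤ m * (t1 * t2 * t3 * t4) := by
            rw [tR]
            exact Nat.mul_le_mul_left _ (Nat.le_mul_of_pos_right _ hRpos)
        _ ≤ _ := by
            have g1 : t1 ≤ a1 := v1 ▸ Nat.le_mul_of_pos_left _ q1
            have g2 : t2 ≤ a2 := v2 ▸ Nat.le_mul_of_pos_left _ q2
            have g3 : t3 ≤ a3 := v3 ▸ Nat.le_mul_of_pos_left _ q3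
            have g4 : t4 ≤ a4 := v4 ▸ Nat.le_mul_of_pos_left _ q4
            gcongr
    · refine le_trans ?_ hV
      simp only [Wit.a1, Wit.a2]
      rw [← e1, ← e2, v1, v2]
      calc a1 * a2 ≤ (a1 * a2) * (m * a3 * a4) := Nat.le_mul_of_pos_right _ (by positivity)
        _ = _ := by ring
    · refine le_trans ?_ hV
      calc n ≤ m * a1 := hlt.le
        _ ≤ (m * a1) * (a2 * a3 * a4) := Nat.le_mul_of_pos_right _ (by positivity)
        _ = _ := by ring
    · simp only [Wit.a1]
      rw [← e1, v1]
      exact Nat.div_lt_of_lt_mul hlt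
  · simp only [Wit.a1]; rw [← e1, v1]
  · simp only [Wit.a2]; rw [← e2, v2]
  · simp only [Wit.a3]; rw [← e3, v3]
  · simp only [Wit.a4]; rw [← e4, v4]

lemma sizes (m n a1 a2 a3 a4 : ℕ) (hm : 0 < m) (hn : 0 < n) (p1 : 0 < a1)
    (l1 : a1 ≤ a2) (l2 : a2 ≤ a3) (l3 : a3 ≤ a4)
    (h : m * (a1 * a2 * a3 * a4) = n * (a2 * a3 * a4 + a1 * a3 * a4 + a1 * a2 * a4 + a1 * a2 * a3)) :
    n < m * a1 ∧ m * a1 ≤ 4 * n ∧ m * a1 * a2 ≤ n * a2 + 3 * n * a1 ∧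
      m * (a1 * a2 * a3 * a4) ≤ 10 ^ 8 * n ^ 16 := by
  have p2 : 0 < a2 := by omega
  have p3 : 0 < a3 := by omega
  have p4 : 0 < a4 := by omega
  have g1 : n < m * a1 := by
    apply Nat.lt_of_mul_lt_mul_right (a := a2 * a3 * a4)
    have : 0 < n * (a1 * a3 * a4) := by positivity
    have e : m * a1 * (a2 * a3 * a4) = m * (a1 * a2 * a3 * a4) := by ring
    rw [e, h, mul_add, mul_add, mul_add]
    omega
  have b23 : a1 * a3 * a4 ≤ a2 * a3 * a4 := by gcongr
  have b24 : a1 * a2 * a4 ≤ a1 * a3 * a4 := by gcongr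
  have b34 : a1 * a2 * a3 ≤ a1 * a2 * a4 := by gcongr
  have g2 : m * a1 ≤ 4 * n := by
    apply Nat.le_of_mul_le_mul_right (c := a2 * a3 * a4) _ (by positivity)
    calc m * a1 * (a2 * a3 * a4) = n * (a2 * a3 * a4 + a1 * a3 * a4 + a1 * a2 * a4 + a1 * a2 * a3) := by
          rw [← h]; ring
      _ ≤ n * (4 * (a2 * a3 * a4)) := by gcongr; omega
      _ = _ := by ring
  have g3 : m * a1 * a2 ≤ n * a2 + 3 * n * a1 := by
    apply Nat.le_of_mul_le_mul_right (c := a3 * a4) _ (by positivity)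
    calc m * a1 * a2 * (a3 * a4) = n * (a2 * a3 * a4 + a1 * a3 * a4 + a1 * a2 * a4 + a1 * a2 * a3) := by
          rw [← h]; ring
      _ ≤ n * (a2 * a3 * a4 + 3 * (a1 * a3 * a4)) := Nat.mul_le_mul_left _ (by omega)
      _ = _ := by ring
  refine ⟨g1, g2, g3, ?_⟩
  have hm4 : m ≤ 4 * n := le_trans (Nat.le_mul_of_pos_right _ p1) g2
  have A1 : a1 ≤ 4 * n := le_trans (Nat.le_mul_of_pos_left _ hm) g2
  have A2 : a2 ≤ 12 * n ^ 2 := by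
    have : (n + 1) * a2 ≤ m * a1 * a2 := Nat.mul_le_mul_right _ g1
    have : a2 ≤ 3 * n * a1 := by nlinarith
    calc a2 ≤ 3 * n * a1 := this
      _ ≤ 3 * n * (4 * n) := by gcongr
      _ = _ := by ring
  have A3 : a3 ≤ 96 * n ^ 4 := by
    have c1 : n * a2 + n * a1 < m * a1 * a2 := by
      apply Nat.lt_of_mul_lt_mul_right (a := a3 * a4)
      have : 0 < n * (a1 * a2 * a4) := by positivity
      nlinarith
    have c2 : m * a1 * a2 * a3 ≤ (n * a2 + n * a1) * a3 + 2 * n * (a1 * a2) := by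
      apply Nat.le_of_mul_le_mul_right (c := a4) _ p4
      calc m * a1 * a2 * a3 * a4 = n * (a2 * a3 * a4 + a1 * a3 * a4 + a1 * a2 * a4 + a1 * a2 * a3) := by
            rw [← h]; ring
        _ ≤ n * (a2 * a3 * a4 + a1 * a3 * a4 + 2 * (a1 * a2 * a4)) :=
          Nat.mul_le_mul_left _ (by omega)
        _ = _ := by ring
    have c3 : (n * a2 + n * a1 + 1) * a3 ≤ m * a1 * a2 * a3 := Nat.mul_le_mul_right _ c1
    have c4 : a3 ≤ 2 * n * (a1 * a2) := by nlinarith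
    calc a3 ≤ 2 * n * (a1 * a2) := c4
      _ ≤ 2 * n * (4 * n * (12 * n ^ 2)) := by gcongr
      _ = _ := by ring
  have A4 : a4 ≤ 4608 * n ^ 8 := by
    have c1 : n * (a2 * a3 + a1 * a3 + a1 * a2) < m * a1 * a2 * a3 := by
      apply Nat.lt_of_mul_lt_mul_right (a := a4)
      have : 0 < n * (a1 * a2 * a3) := by positivity
      nlinarith
    have c3 : (n * (a2 * a3 + a1 * a3 + a1 * a2) + 1) * a4 ≤ m * a1 * a2 * a3 * a4 :=
      Nat.mul_le_mul_right _ c1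
    have c4 : a4 ≤ n * (a1 * a2 * a3) := by nlinarith
    calc a4 ≤ n * (a1 * a2 * a3) := c4
      _ ≤ n * (4 * n * (12 * n ^ 2) * (96 * n ^ 4)) := by gcongr
      _ = _ := by ring
  calc m * (a1 * a2 * a3 * a4)
      ≤ (4 * n) * ((4 * n) * (12 * n ^ 2) * (96 * n ^ 4) * (4608 * n ^ 8)) := by gcongr
    _ = 84934656 * n ^ 16 := by ring
    _ ≤ _ := by gcongr; norm_num

lemma key_small {m n V : ℕ} {w : Wit} (hw : OK m n V w) (h1 : n < m * w.a1)
    (h2 : m * w.a1 ≤ 4 * n) (h3 : m * w.a1 * w.a2 ≤ n * w.a2 + 3 * n * w.a1) (P Q B : ℝ)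
    (hP : 0 < P) (hQ : 0 < Q) (hP3 : P ^ 3 * m ^ 2 = n ^ 4) (hQ11 : Q ^ 11 * m ^ 18 = n ^ 18)
    (hB : B = 24 * (P + Q)) :
    (w.K0 : ℝ) ≤ B ∨ (w.K1 m n : ℝ) ≤ B ∨ (w.K2 m n : ℝ) ≤ B ∨ (w.K3 : ℝ) ≤ B ∨ (w.K4 : ℝ) ≤ B ∨
      (w.K5 m n : ℝ) ≤ B := by
  by_contra hcon
  push Not at hcon
  obtain ⟨l0, l1, l2, l3, l4, l5⟩ := hcon
  have hBpos : 0 < B := by rw [hB]; positivity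
  have hm := hw.hm
  have hn := hw.hn
  set a1 := w.a1 with ha1
  set a2 := w.a2 with ha2
  set c := w.kap m n with hc
  -- products of keys
  have hX : w.K1 m n * w.K2 m n * w.K5 m n ≤ c ^ 3 * a2 ^ 2 := by
    have e : w.K1 m n * w.K2 m n * w.K5 m n = c ^ 3 * (w.x23 * w.x24 * w.x234) ^ 2 := by
      unfold Wit.K1 Wit.K2 Wit.K5; rw [← hc]; ring
    have e2 : a2 = (w.x23 * w.x24 * w.x234) * (w.k2 * (w.x12 * w.x123 * w.x124 * w.x1234)) := by
      rw [ha2]; unfold Wit.a2; ring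
    rw [e]
    gcongr
    rw [e2]
    have := hw.kpos.2
    have := hw.px12
    have := hw.px123
    have := hw.px124
    have := hw.px1234
    exact Nat.le_mul_of_pos_right _ (by positivity)
  have hY : w.K0 * w.K3 * w.K4 * (w.K1 m n * w.K2 m n) ≤ a1 ^ 2 * a2 ^ 4 * c ^ 2 := by
    have e : a1 ^ 2 * a2 ^ 4 * c ^ 2 = w.K0 * w.K3 * w.K4 * (w.K1 m n * w.K2 m n) *
        ((w.x12 * w.x123 * w.x124 * w.x1234) ^ 3 * w.k1 ^ 2 * w.k2 ^ 2) := by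
      unfold Wit.K0 Wit.K1 Wit.K2 Wit.K3 Wit.K4
      rw [← hc, ← ha2]
      have e1 : a1 = w.k1 * (w.x12 * w.x13 * w.x14 * w.x123 * w.x124 * w.x134 * w.x1234) := ha1
      have e2 : a2 = w.k2 * (w.x12 * w.x23 * w.x24 * w.x123 * w.x124 * w.x234 * w.x1234) := ha2
      calc a1 ^ 2 * a2 ^ 4 * c ^ 2 = a1 ^ 2 * a2 ^ 2 * (a2 ^ 2 * c ^ 2) := by ring
        _ = (w.k1 * (w.x12 * w.x13 * w.x14 * w.x123 * w.x124 * w.x134 * w.x1234)) ^ 2 *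
          (w.k2 * (w.x12 * w.x23 * w.x24 * w.x123 * w.x124 * w.x234 * w.x1234)) ^ 2 *
          (a2 ^ 2 * c ^ 2) := by rw [← e1, ← e2]
        _ = _ := by ring
    rw [e]
    have := hw.kpos.1
    have := hw.kpos.2
    have := hw.px12
    have := hw.px123
    have := hw.px124
    have := hw.px1234
    exact Nat.le_mul_of_pos_right _ (by positivity)
  have hXr : B ^ 3 < (c : ℝ) ^ 3 * (a2 : ℝ) ^ 2 := by
    calc B ^ 3 = B * B * B := by ring
      _ < w.K1 m n * w.K2 m n * w.K5 m n := by gcongr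
      _ ≤ _ := by exact_mod_cast hX
  have hYr : B ^ 5 < (a1 : ℝ) ^ 2 * (a2 : ℝ) ^ 4 * (c : ℝ) ^ 2 := by
    calc B ^ 5 = B * B * B * (B * B) := by ring
      _ < w.K0 * w.K3 * w.K4 * (w.K1 m n * w.K2 m n) := by gcongr
      _ ≤ _ := by exact_mod_cast hY
  have hcm : m * c + n < m * a1 + m := by
    have e1 : n < m * (n / m) + m := by
      have := Nat.div_add_mod n m
      have := Nat.mod_lt n hm
      omega
    have e2 : c + n / m = a1 := by
      have := hw.hlt
      rw [hc]; unfold Wit.kap; omega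
    have : m * c + m * (n / m) = m * a1 := by rw [← e2]; ring
    omega
  obtain ⟨u, hu⟩ := Nat.exists_eq_add_of_lt h1
  set u' := u + 1 with hu'
  have hu2 : m * a1 = n + u' := by omega
  have hau : u' * a2 ≤ 3 * n * a1 := by
    have : m * a1 * a2 = n * a2 + u' * a2 := by rw [hu2]; ring
    omega
  have hmR : (0 : ℝ) < m := by exact_mod_cast hm
  by_cases hum : u' ≤ m
  · have hc1 : c ≤ 1 := by
      by_contra hcc
      have : m * 2 ≤ m * c := Nat.mul_le_mul_left _ (by omega)
      omega
    have ha : m * a2 ≤ 12 * n ^ 2 := by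
      have : 1 * a2 ≤ u' * a2 := Nat.mul_le_mul_right _ (by omega)
      calc m * a2 ≤ m * (3 * n * a1) := by gcongr; omega
        _ = 3 * n * (m * a1) := by ring
        _ ≤ 3 * n * (4 * n) := by gcongr
        _ = _ := by ring
    have haR : (m : ℝ) * a2 ≤ 12 * n ^ 2 := by exact_mod_cast ha
    have hcR : (c : ℝ) ≤ 1 := by exact_mod_cast hc1
    have hPB : (24 * P) ^ 3 ≤ B ^ 3 := by rw [hB]; gcongr; linarith
    have : (24 * P) ^ 3 * m ^ 2 < 144 * (n : ℝ) ^ 4 := by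
      calc (24 * P) ^ 3 * m ^ 2 ≤ B ^ 3 * m ^ 2 := by gcongr
        _ < (c : ℝ) ^ 3 * (a2 : ℝ) ^ 2 * m ^ 2 := by gcongr
        _ ≤ 1 ^ 3 * (a2 : ℝ) ^ 2 * m ^ 2 := by gcongr
        _ = (m * a2) ^ 2 := by ring
        _ ≤ (12 * (n : ℝ) ^ 2) ^ 2 := by gcongr
        _ = _ := by ring
    have e : (24 * P) ^ 3 * m ^ 2 = 13824 * (n : ℝ) ^ 4 := by rw [← hP3]; ring
    rw [e] at this
    have : (0 : ℝ) ≤ (n : ℝ) ^ 4 := by positivity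
    linarith
  · have hca : m ^ 2 * (c * a2) ≤ 24 * n ^ 2 := by
      calc m ^ 2 * (c * a2) = m * ((m * c) * a2) := by ring
        _ ≤ m * ((2 * u') * a2) :=
          Nat.mul_le_mul_left _ (Nat.mul_le_mul_right _ (by omega))
        _ = 2 * m * (u' * a2) := by ring
        _ ≤ 2 * m * (3 * n * a1) := by gcongr
        _ = 6 * n * (m * a1) := by ring
        _ ≤ 6 * n * (4 * n) := by gcongr
        _ = _ := by ring
    have hcaR : (m : ℝ) ^ 2 * (c * a2) ≤ 24 * n ^ 2 := by exact_mod_cast hca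
    have h2R : (m : ℝ) * a1 ≤ 4 * n := by exact_mod_cast h2
    have hQB : (24 * Q) ^ 11 ≤ B ^ 11 := by rw [hB]; gcongr; linarith
    have : (24 * Q) ^ 11 * m ^ 18 < 24 ^ 8 * 16 * (n : ℝ) ^ 18 := by
      calc (24 * Q) ^ 11 * m ^ 18 ≤ B ^ 11 * m ^ 18 := by gcongr
        _ = B ^ 3 * B ^ 3 * B ^ 5 * m ^ 18 := by ring
        _ < ((c : ℝ) ^ 3 * (a2 : ℝ) ^ 2) * ((c : ℝ) ^ 3 * (a2 : ℝ) ^ 2) *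
            ((a1 : ℝ) ^ 2 * (a2 : ℝ) ^ 4 * (c : ℝ) ^ 2) * m ^ 18 := by gcongr
        _ = ((m : ℝ) ^ 2 * (c * a2)) ^ 8 * (m * a1) ^ 2 := by ring
        _ ≤ (24 * (n : ℝ) ^ 2) ^ 8 * (4 * n) ^ 2 := by gcongr
        _ = _ := by ring
    have e : (24 * Q) ^ 11 * m ^ 18 = 24 ^ 11 * (n : ℝ) ^ 18 := by rw [← hQ11]; ring
    rw [e] at this
    have : (0 : ℝ) ≤ (n : ℝ) ^ 18 := by positivity
    linarith


/-- A monotone solution in `ℚ` satisfies the cleared equation in `ℕ`. -/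
lemma clear_eq (m n : ℕ) (hn : 0 < n) (a : Fin 4 → ℕ) (ha : ∀ i, 0 < a i)
    (h : (m : ℚ) / n = ∑ i, (1 : ℚ) / a i) :
    m * (a 0 * a 1 * a 2 * a 3) = n * (a 1 * a 2 * a 3 + a 0 * a 2 * a 3 + a 0 * a 1 * a 3 +
      a 0 * a 1 * a 2) := by
  rw [Fin.sum_univ_four] at h
  have q0 : (a 0 : ℚ) ≠ 0 := by exact_mod_cast (ha 0).ne'
  have q1 : (a 1 : ℚ) ≠ 0 := by exact_mod_cast (ha 1).ne'
  have q2 : (a 2 : ℚ) ≠ 0 := by exact_mod_cast (ha 2).ne'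
  have q3 : (a 3 : ℚ) ≠ 0 := by exact_mod_cast (ha 3).ne'
  have qn : (n : ℚ) ≠ 0 := by exact_mod_cast hn.ne'
  have e : (m : ℚ) * (a 0 * a 1 * a 2 * a 3) = m / n * (n * (a 0 * a 1 * a 2 * a 3)) := by
    field_simp
  have : (m : ℚ) * (a 0 * a 1 * a 2 * a 3) = n * (a 1 * a 2 * a 3 + a 0 * a 2 * a 3 +
      a 0 * a 1 * a 3 + a 0 * a 1 * a 2) := by
    rw [e, h]
    field_simp
  exact_mod_cast this

lemma CB_or {W : Type} {p q : W → Prop} {K K' : ℕ} (hp : CB p K) (hq : CB q K') :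
    CB (fun w => p w ∨ q w) (K + K') := by
  classical
  intro T hT
  rw [← Finset.card_filter_add_card_filter_not (s := T) p]
  refine Nat.add_le_add (hp _ fun w hw => (Finset.mem_filter.1 hw).2) (hq _ fun w hw => ?_)
  have h := Finset.mem_filter.1 hw
  exact (hT w h.1).resolve_left h.2

lemma numSols_le {m n D Bn : ℕ} {P Q : ℝ} (hm : 0 < m) (hn : 0 < n)
    (hP : 0 < P) (hQ : 0 < Q) (hP3 : P ^ 3 * m ^ 2 = n ^ 4) (hQ11 : Q ^ 11 * m ^ 18 = n ^ 18)
    (hB : Bn = ⌊24 * (P + Q)⌋₊) (hD1 : 1 ≤ D)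
    (hD : ∀ k, k ≠ 0 → k ≤ 2 * (10 ^ 8 * n ^ 16) ^ 2 → k.divisors.card ≤ D) :
    numSols 4 m n ≤ 6 * (Bn * D ^ 16) := by
  classical
  have hVM : 10 ^ 8 * n ^ 16 ≤ 2 * (10 ^ 8 * n ^ 16) ^ 2 := by
    have : 1 ≤ 10 ^ 8 * n ^ 16 := Nat.succ_le_of_lt (by positivity)
    nlinarith
  generalize hVV : 10 ^ 8 * n ^ 16 = V at *
  have hall := CB_or (count0 (m := m) (n := n) (V := V) (B := Bn) hD hD1 le_rfl hVM)
    (CB_or (count1 (m := m) (n := n) (V := V) (B := Bn) hD hD1 le_rfl hVM)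
    (CB_or (count2 (m := m) (n := n) (V := V) (B := Bn) hD hD1 le_rfl hVM)
    (CB_or (count3 (m := m) (n := n) (V := V) (B := Bn) hD hD1 le_rfl hVM)
    (CB_or (count4 (m := m) (n := n) (V := V) (B := Bn) hD hD1 le_rfl hVM)
    (count5 (m := m) (n := n) (V := V) (B := Bn) hD hD1 le_rfl hVM)))))
  unfold numSols
  rcases finite_or_infinite {a : Fin 4 → ℕ // (∀ i, 0 < a i) ∧ Monotone a ∧
    (m : ℚ) / n = ∑ i, (1 : ℚ) / a i} with hfin | hinf
  swap
  · rw [Nat.card_eq_zero_of_infinite]; exact Nat.zero_le _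
  have := Fintype.ofFinite {a : Fin 4 → ℕ // (∀ i, 0 < a i) ∧ Monotone a ∧
    (m : ℚ) / n = ∑ i, (1 : ℚ) / a i}
  rw [Nat.card_eq_fintype_card, ← Finset.card_univ]
  have hex : ∀ a : {a : Fin 4 → ℕ // (∀ i, 0 < a i) ∧ Monotone a ∧
      (m : ℚ) / n = ∑ i, (1 : ℚ) / a i}, ∃ w : Wit,
      (w.a1 = a.1 0 ∧ w.a2 = a.1 1 ∧ w.a3 = a.1 2 ∧ w.a4 = a.1 3) ∧
      ((OK m n V w ∧ w.K0 ≤ Bn) ∨ (OK m n V w ∧ w.K1 m n ≤ Bn) ∨ (OK m n V w ∧ w.K2 m n ≤ Bn) ∨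
      (OK m n V w ∧ w.K3 ≤ Bn) ∨ (OK m n V w ∧ w.K4 ≤ Bn) ∨ (OK m n V w ∧ w.K5 m n ≤ Bn)) := by
    rintro ⟨a, ha, hmono, h⟩
    have heq := clear_eq m n hn a ha h
    obtain ⟨s1, s2, s3, s4⟩ := sizes m n (a 0) (a 1) (a 2) (a 3) hm hn (ha 0)
      (hmono (by decide)) (hmono (by decide)) (hmono (by decide)) heq
    rw [hVV] at s4
    obtain ⟨w, hw, w1, w2, w3, w4⟩ := exists_wit m n V (a 0) (a 1) (a 2) (a 3) hm hn (ha 0) (ha 1)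
      (ha 2) (ha 3) heq s4 s1
    refine ⟨w, ⟨w1, w2, w3, w4⟩, ?_⟩
    rw [← w1] at s1 s2
    rw [← w1, ← w2] at s3
    have hk := key_small hw s1 s2 s3 P Q _ hP hQ hP3 hQ11 rfl
    have fl : ∀ x : ℕ, (x : ℝ) ≤ 24 * (P + Q) → x ≤ Bn := fun x hx => hB ▸ Nat.le_floor hx
    exact hk.imp (fun h => ⟨hw, fl _ h⟩) (Or.imp (fun h => ⟨hw, fl _ h⟩)
      (Or.imp (fun h => ⟨hw, fl _ h⟩) (Or.imp (fun h => ⟨hw, fl _ h⟩)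
      (Or.imp (fun h => ⟨hw, fl _ h⟩) (fun h => ⟨hw, fl _ h⟩)))))
  choose g hg1 hg2 using hex
  have hinj : Function.Injective g := by
    intro a b hab
    have h1 := hg1 a
    have h2 := hg1 b
    rw [hab] at h1
    apply Subtype.ext
    funext i
    fin_cases i
    · exact h1.1.symm.trans h2.1
    · exact h1.2.1.symm.trans h2.2.1
    · exact h1.2.2.1.symm.trans h2.2.2.1
    · exact h1.2.2.2.symm.trans h2.2.2.2
  have hfinal := hall (Finset.univ.image g) (by
    intro w hw
    obtain ⟨a, -, rfl⟩ := Finset.mem_image.1 hw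
    exact hg2 a)
  rw [Finset.card_image_of_injective _ hinj] at hfinal
  omega

theorem stmt_2 : ∀ ε : ℝ, 0 < ε → ∃ C : ℝ, 0 < C ∧
    ∀ m n : ℕ, 0 < m → 0 < n →
      (numSols 4 m n : ℝ) ≤ C * (n : ℝ) ^ ε *
        ((n : ℝ) ^ ((4 : ℝ) / 3) / (m : ℝ) ^ ((2 : ℝ) / 3) +
          (n : ℝ) ^ ((28 : ℝ) / 17) / (m : ℝ) ^ ((8 : ℝ) / 5)) := by
  intro ε hε
  obtain ⟨C, hC, hdiv⟩ := divisor_bound_s2 (ε / 512) (by positivity)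
  set A : ℝ := C * (2 * (10 ^ 8) ^ 2 : ℝ) ^ (ε / 512) + 1 with hA
  have hApos : 0 < A := by positivity
  refine ⟨144 * A ^ 16, by positivity, ?_⟩
  intro m n hm hn
  have hm0 : (0 : ℝ) < m := by exact_mod_cast hm
  have hn0 : (0 : ℝ) < n := by exact_mod_cast hn
  have hm1 : (1 : ℝ) ≤ m := by exact_mod_cast hm
  have hn1 : (1 : ℝ) ≤ n := by exact_mod_cast hn
  set P : ℝ := (n : ℝ) ^ ((4 : ℝ) / 3) / (m : ℝ) ^ ((2 : ℝ) / 3) with hP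
  set Q : ℝ := (n : ℝ) ^ ((18 : ℝ) / 11) / (m : ℝ) ^ ((18 : ℝ) / 11) with hQ
  have hPpos : 0 < P := by positivity
  have hQpos : 0 < Q := by positivity
  have pw : ∀ (x : ℝ) (s : ℝ) (j l : ℕ), 0 < x → s * j = l → (x ^ s) ^ j = x ^ l := by
    intro x s j l hx h
    rw [← Real.rpow_mul_natCast hx.le, h, Real.rpow_natCast]
  have hP3 : P ^ 3 * m ^ 2 = n ^ 4 := by
    rw [hP, div_pow, pw _ _ 3 4 hn0 (by norm_num), pw _ _ 3 2 hm0 (by norm_num)]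
    field_simp
  have hQ11 : Q ^ 11 * m ^ 18 = n ^ 18 := by
    rw [hQ, div_pow, pw _ _ 11 18 hn0 (by norm_num), pw _ _ 11 18 hm0 (by norm_num)]
    field_simp
  have hQle : Q ≤ (n : ℝ) ^ ((28 : ℝ) / 17) / (m : ℝ) ^ ((8 : ℝ) / 5) := by
    rw [hQ]
    have e1 : (n : ℝ) ^ ((18 : ℝ) / 11) ≤ (n : ℝ) ^ ((28 : ℝ) / 17) :=
      Real.rpow_le_rpow_of_exponent_le hn1 (by norm_num)
    have e2 : (m : ℝ) ^ ((8 : ℝ) / 5) ≤ (m : ℝ) ^ ((18 : ℝ) / 11) :=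
      Real.rpow_le_rpow_of_exponent_le hm1 (by norm_num)
    gcongr
  set y : ℝ := (n : ℝ) ^ (ε / 16) with hy
  have hy1 : 1 ≤ y := Real.one_le_rpow hn1 (by positivity)
  set D : ℕ := ⌊A * y⌋₊ with hD
  have hA1 : 1 ≤ A := by rw [hA]; linarith [show 0 < C * (2 * (10 ^ 8) ^ 2 : ℝ) ^ (ε / 512) by positivity]
  have hAy : 1 ≤ A * y := one_le_mul_of_one_le_of_one_le hA1 hy1
  have hD1 : 1 ≤ D := Nat.le_floor (by exact_mod_cast hAy)
  have hDb : ∀ k, k ≠ 0 → k ≤ 2 * (10 ^ 8 * n ^ 16) ^ 2 → k.divisors.card ≤ D := by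
    intro k hk hkM
    apply Nat.le_floor
    have hkR : (k : ℝ) ≤ (2 * (10 ^ 8) ^ 2) * (n : ℝ) ^ 32 := by
      calc (k : ℝ) ≤ 2 * (10 ^ 8 * (n : ℝ) ^ 16) ^ 2 := by exact_mod_cast hkM
        _ = _ := by ring
    have e : ((n : ℝ) ^ 32) ^ (ε / 512) = y := by
      rw [hy, ← Real.rpow_natCast, ← Real.rpow_mul hn0.le]
      congr 1
      push_cast
      ring
    calc (k.divisors.card : ℝ) ≤ C * (k : ℝ) ^ (ε / 512) := hdiv k hk
      _ ≤ C * ((2 * (10 ^ 8) ^ 2) * (n : ℝ) ^ 32) ^ (ε / 512) := by gcongr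
      _ = (A - 1) * y := by
        rw [Real.mul_rpow (by positivity) (by positivity), e, hA]; ring
      _ ≤ A * y := by gcongr; linarith
  have hmain := numSols_le hm hn hPpos hQpos hP3 hQ11 rfl hD1 hDb
  have hfl : ((⌊24 * (P + Q)⌋₊ : ℕ) : ℝ) ≤ 24 * (P + Q) := Nat.floor_le (by positivity)
  have hDR : (D : ℝ) ≤ A * y := Nat.floor_le (by positivity)
  have hy16 : y ^ 16 = (n : ℝ) ^ ε := by
    rw [hy, ← Real.rpow_mul_natCast hn0.le]
    congr 1
    push_cast
    ring
  calc (numSols 4 m n : ℝ) ≤ 6 * ((⌊24 * (P + Q)⌋₊ : ℕ) * (D : ℝ) ^ 16) := by exact_mod_cast hmain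
    _ ≤ 6 * ((24 * (P + Q)) * (A * y) ^ 16) := by gcongr
    _ = 144 * A ^ 16 * y ^ 16 * (P + Q) := by ring
    _ ≤ _ := by rw [hy16]; gcongr
end
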